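/- Let H be a finite-dimensional non-cosemisimple Hopf algebra with the dual Chevalley property over an algebraically closed field of characteristic 0, and let N := exp(H₀). Then there exists a basic multiplicative matrix 𝒞 over H and a non-trivial (𝒞,1)-primitive matrix 𝒳 such that S²(𝒳) = q𝒳 (entrywise) for some N-th root of unity q ∈ k. -/

import Mathlib

open TensorProduct

noncomputable section

variable (k H : Type*) [CommRing k] [Ring H] [Bialgebra k H]

/-- Convolution product `f * g = m ∘ (f ⊗ g) ∘ Δ` on linear endomorphisms. -/
def conv (f g : Module.End k H) : Module.End k H :=
  LinearMap.mul' k H ∘ₗ TensorProduct.map f g ∘ₗ Coalgebra.comul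

/-- The convolution unit `u ∘ ε`. -/
def convOne : Module.End k H := (Algebra.linearMap k H) ∘ₗ Coalgebra.counit

/-- `convSeq F n = m_n ∘ (F 0 ⊗ F 1 ⊗ ⋯ ⊗ F (n-1)) ∘ Δ_n` (as an iterated convolution). -/
def convSeq : (ℕ → Module.End k H) → ℕ → Module.End k H
  | _, 0 => convOne k H
  | F, n + 1 => conv k H (F 0) (convSeq (fun j => F (j + 1)) n)

/-- The `n`-th Sweedler power `[n] = m_n ∘ Δ_n` as a linear endomorphism. -/
def sweedlerPow (n : ℕ) : Module.End k H := convSeq k H (fun _ => LinearMap.id) n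

/-- The twisted Sweedler power `m_n ∘ (id ⊗ T ⊗ T² ⊗ ⋯ ⊗ T^(n-1)) ∘ Δ_n`. -/
def twistPow (T : Module.End k H) (n : ℕ) : Module.End k H :=
  convSeq k H (fun j => T ^ j) n

/-- `exp₀(H)`: the least `n ≥ 1` with `[n] = u ∘ ε`, in `ℕ ∪ {∞}` (`sInf ∅ = ∞`). -/
def exp0 : ℕ∞ :=
  sInf {e : ℕ∞ | ∃ n : ℕ, e = n ∧ 0 < n ∧ sweedlerPow k H n = convOne k H}

/-- The `T`-twisted exponent: least `n ≥ 1` with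
`m_n ∘ (id ⊗ T ⊗ ⋯ ⊗ T^(n-1)) ∘ Δ_n = u ∘ ε`, in `ℕ ∪ {∞}`.  For `T = S⁻²` this is
`exp(H)` and for `T = S^(2i)` this is the twisted exponent `exp_{2i}(H)`. -/
def expAt (T : Module.End k H) : ℕ∞ :=
  sInf {e : ℕ∞ | ∃ n : ℕ, e = n ∧ 0 < n ∧ twistPow k H T n = convOne k H}

/-- `S` is a subcoalgebra: `Δ(S) ⊆ S ⊗ S` (as a subspace of `H ⊗ H`). -/
def IsSubcoalg (S : Submodule k H) : Prop :=
  ∀ s ∈ S, Coalgebra.comul (R := k) s ∈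
    LinearMap.range (TensorProduct.map S.subtype S.subtype)

/-- `S` is a simple subcoalgebra: nonzero, a subcoalgebra, and with no proper nonzero
subcoalgebras. -/
def IsSimpleSubcoalg (S : Submodule k H) : Prop :=
  S ≠ ⊥ ∧ IsSubcoalg k H S ∧ ∀ T ≤ S, IsSubcoalg k H T → T = ⊥ ∨ T = S

/-- The coradical `H₀`: the sum of all simple subcoalgebras. -/
def coradical : Submodule k H := sSup {S : Submodule k H | IsSimpleSubcoalg k H S}

/-- The image of `S ⊗ T` in `H ⊗ H`. -/
def tsub (S T : Submodule k H) : Submodule k (H ⊗[k] H) :=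
  LinearMap.range (TensorProduct.map S.subtype T.subtype)

/-- The coradical filtration, `H_0 = H₀` and `H_n = Δ⁻¹(H ⊗ H_{n-1} + H₀ ⊗ H)`. -/
def coradFilt : ℕ → Submodule k H
  | 0 => coradical k H
  | n + 1 => Submodule.comap (Coalgebra.comul (R := k))
      (tsub k H ⊤ (coradFilt n) ⊔ tsub k H (coradical k H) ⊤)

/-- The Loewy length: the least `l ≥ 1` with `H_{l-1} = H`. -/
def loewyLength : ℕ := sInf {l : ℕ | 0 < l ∧ coradFilt k H (l - 1) = ⊤}

/-- The dual Chevalley property: the coradical is a Hopf subalgebra, i.e. it contains `1`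
and is closed under multiplication and the antipode. -/
def DualChevalley [HopfAlgebra k H] : Prop :=
  (1 : H) ∈ coradical k H ∧
  (∀ a ∈ coradical k H, ∀ b ∈ coradical k H, a * b ∈ coradical k H) ∧
  (∀ a ∈ coradical k H, HopfAlgebra.antipode (R := k) a ∈ coradical k H)


section basics
variable {F A : Type*} [Field F] [Ring A] [HopfAlgebra F A]

/-- Slice a tensor with a functional on the left factor. -/
def slL (f : A →ₗ[F] F) : A ⊗[F] A →ₗ[F] A :=
  (TensorProduct.lid F A).toLinearMap ∘ₗ TensorProduct.map f LinearMap.id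

/-- Slice a tensor with a functional on the right factor. -/
def slR (f : A →ₗ[F] F) : A ⊗[F] A →ₗ[F] A :=
  (TensorProduct.rid F A).toLinearMap ∘ₗ TensorProduct.map LinearMap.id f

theorem slL_tmul (f : A →ₗ[F] F) (a b : A) : slL f (a ⊗ₜ[F] b) = f a • b := by
  simp [slL]

theorem slR_tmul (f : A →ₗ[F] F) (a b : A) : slR f (a ⊗ₜ[F] b) = f b • a := by
  simp [slR]

theorem slR_add (f g : A →ₗ[F] F) (z : A ⊗[F] A) : slR (f + g) z = slR f z + slR g z := by
  induction z with
  | zero => simp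
  | tmul a b => simp [slR_tmul, add_smul]
  | add x y hx hy => simp only [map_add, hx, hy]; abel

theorem slR_smul (t : F) (f : A →ₗ[F] F) (z : A ⊗[F] A) : slR (t • f) z = t • slR f z := by
  induction z with
  | zero => simp
  | tmul a b => simp [slR_tmul, mul_smul]
  | add x y hx hy => simp only [map_add, hx, hy, smul_add]

theorem slR_zero (z : A ⊗[F] A) : slR (0 : A →ₗ[F] F) z = 0 := by
  simpa using slR_smul (0 : F) (0 : A →ₗ[F] F) z

theorem slR_sub (f g : A →ₗ[F] F) (z : A ⊗[F] A) : slR (f - g) z = slR f z - slR g z := by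
  rw [sub_eq_add_neg, slR_add, ← neg_one_smul F g, slR_smul]; simp [sub_eq_add_neg]

theorem slR_sum {ι : Type*} (s : Finset ι) (f : ι → A →ₗ[F] F) (z : A ⊗[F] A) :
    slR (∑ i ∈ s, f i) z = ∑ i ∈ s, slR (f i) z := by
  classical
  induction s using Finset.induction_on with
  | empty => simp [slR_zero]
  | insert a s ha ih => rw [Finset.sum_insert ha, Finset.sum_insert ha, slR_add, ih]

theorem sl_comm (f g : A →ₗ[F] F) (z : A ⊗[F] A) : f (slR g z) = g (slL f z) := by
  induction z with
  | zero => simp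
  | tmul a b => simp [slR_tmul, slL_tmul, mul_comm]
  | add x y hx hy => simp only [map_add, hx, hy]

theorem mul_map_eq (f g : A →ₗ[F] F) (z : A ⊗[F] A) :
    LinearMap.mul' F F (TensorProduct.map f g z) = f (slR g z) := by
  induction z with
  | zero => simp
  | tmul a b => simp [slR_tmul, mul_comm]
  | add x y hx hy => simp only [map_add, hx, hy]

theorem dual_ext {a b : A} (h : ∀ f : A →ₗ[F] F, f a = f b) : a = b := by
  rw [← sub_eq_zero]
  refine (Module.forall_dual_apply_eq_zero_iff F _).1 fun f => ?_
  rw [map_sub, h, sub_self]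

variable [FiniteDimensional F A]

theorem slR_ext {z w : A ⊗[F] A} (h : ∀ f : A →ₗ[F] F, slR f z = slR f w) : z = w := by
  let b := Module.finBasis F A
  apply (b.tensorProduct b).ext_elem
  rintro ⟨i, j⟩
  have key : ∀ z : A ⊗[F] A, (b.tensorProduct b).repr z (i, j) = b.coord i (slR (b.coord j) z) := by
    intro z
    induction z with
    | zero => simp
    | tmul a c => simp [slR_tmul, mul_comm]
    | add x y hx hy => simp only [map_add, hx, hy, Finsupp.add_apply]
  rw [key, key, h]

theorem slL_ext {z w : A ⊗[F] A} (h : ∀ f : A →ₗ[F] F, slL f z = slL f w) : z = w := by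
  apply slR_ext
  intro f
  refine dual_ext (F := F) fun g => ?_
  rw [sl_comm, sl_comm, h]

/-- subcoalgebras through slices -/
theorem isSubcoalg_iff (S : Submodule F A) :
    IsSubcoalg F A S ↔ ∀ s ∈ S, ∀ f : A →ₗ[F] F,
      slL f (Coalgebra.comul (R := F) s) ∈ S ∧ slR f (Coalgebra.comul (R := F) s) ∈ S := by
  constructor
  · intro h s hs f
    obtain ⟨w, hw⟩ := h s hs
    rw [← hw]
    clear hw
    induction w with
    | zero => simp
    | tmul a b =>
      simp only [TensorProduct.map_tmul, slL_tmul, slR_tmul]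
      exact ⟨S.smul_mem _ b.2, S.smul_mem _ a.2⟩
    | add x y hx hy =>
      simp only [map_add]
      exact ⟨S.add_mem hx.1 hy.1, S.add_mem hx.2 hy.2⟩
  · intro h s hs
    obtain ⟨P, hP⟩ := S.subtype.exists_leftInverse_of_injective (Submodule.ker_subtype S)
    have hP' : ∀ a ∈ S, ((P a : S) : A) = a := fun a ha => by
      have := LinearMap.congr_fun hP ⟨a, ha⟩
      simpa using congrArg Subtype.val this
    set z := Coalgebra.comul (R := F) s with hz
    refine ⟨TensorProduct.map P P z, ?_⟩
    have h0 : TensorProduct.map S.subtype S.subtype (TensorProduct.map P P z)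
        = TensorProduct.map (S.subtype ∘ₗ P) (S.subtype ∘ₗ P) z := by
      rw [TensorProduct.map_comp]; rfl
    rw [h0]
    have h1 : TensorProduct.map LinearMap.id (S.subtype ∘ₗ P) z = z := by
      apply slL_ext
      intro f
      have : ∀ z, slL f (TensorProduct.map LinearMap.id (S.subtype ∘ₗ P) z)
          = (S.subtype ∘ₗ P) (slL f z) := by
        intro z
        induction z with
        | zero => simp
        | tmul a b => simp [slL_tmul]
        | add x y hx hy => simp only [map_add, hx, hy]
      rw [this]
      exact hP' _ (h s hs f).1
    have h2 : TensorProduct.map (S.subtype ∘ₗ P) LinearMap.id z = z := by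
      apply slR_ext
      intro f
      have : ∀ z, slR f (TensorProduct.map (S.subtype ∘ₗ P) LinearMap.id z)
          = (S.subtype ∘ₗ P) (slR f z) := by
        intro z
        induction z with
        | zero => simp
        | tmul a b => simp [slR_tmul]
        | add x y hx hy => simp only [map_add, hx, hy]
      rw [this]
      exact hP' _ (h s hs f).2
    have h3 : TensorProduct.map (S.subtype ∘ₗ P) (S.subtype ∘ₗ P) z
        = TensorProduct.map (S.subtype ∘ₗ P) LinearMap.id
          (TensorProduct.map LinearMap.id (S.subtype ∘ₗ P) z) := by
      have := LinearMap.congr_fun (TensorProduct.map_comp (S.subtype ∘ₗ P) (LinearMap.id (R := F) (M := A))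
        (LinearMap.id (R := F) (M := A)) (S.subtype ∘ₗ P)) z
      simpa using this
    rw [h3, h1, h2]

end basics

section mm
variable {F A : Type*} [Field F] [Ring A] [HopfAlgebra F A]

/-- multiplicative matrices -/
def IsMM (F : Type*) {A : Type*} [Field F] [Ring A] [HopfAlgebra F A] {ι : Type*} [Fintype ι]
    [DecidableEq ι] (c : Matrix ι ι A) : Prop :=
  (∀ i j, Coalgebra.comul (R := F) (c i j) = ∑ l, c i l ⊗ₜ[F] c l j) ∧
  ∀ i j, Coalgebra.counit (R := F) (c i j) = if i = j then (1 : F) else 0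

variable {ι : Type*} [Fintype ι] [DecidableEq ι] {c : Matrix ι ι A}

theorem IsMM.S_mul (h : IsMM F c) (i j : ι) :
    ∑ l, HopfAlgebra.antipode F (c i l) * c l j = if i = j then 1 else 0 := by
  have := HopfAlgebra.mul_antipode_rTensor_comul_apply (R := F) (c i j)
  rw [h.1, h.2] at this
  simp only [map_sum, LinearMap.rTensor_tmul, LinearMap.mul'_apply] at this
  rw [this]; split_ifs <;> simp

theorem IsMM.mul_S (h : IsMM F c) (i j : ι) :
    ∑ l, c i l * HopfAlgebra.antipode F (c l j) = if i = j then 1 else 0 := by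
  have := HopfAlgebra.mul_antipode_lTensor_comul_apply (R := F) (c i j)
  rw [h.1, h.2] at this
  simp only [map_sum, LinearMap.lTensor_tmul, LinearMap.mul'_apply] at this
  rw [this]; split_ifs <;> simp

theorem IsMM.S2_mul (h : IsMM F c) (i j : ι) :
    ∑ l, HopfAlgebra.antipode F (HopfAlgebra.antipode F (c l j)) * HopfAlgebra.antipode F (c i l)
      = if i = j then 1 else 0 := by
  have := congrArg (HopfAlgebra.antipode F) (h.mul_S i j)
  rw [map_sum] at this
  simp only [HopfAlgebra.antipode_mul_antidistrib] at this
  rw [this]; split_ifs <;> simp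

theorem IsMM.comul_S (h : IsMM F c) (i j : ι) :
    Coalgebra.comul (R := F) (HopfAlgebra.antipode F (c i j)) =
      ∑ l, HopfAlgebra.antipode F (c l j) ⊗ₜ[F] HopfAlgebra.antipode F (c i l) := by
  let M : Matrix ι ι (A ⊗[F] A) := fun i j => Coalgebra.comul (R := F) (c i j)
  let X : Matrix ι ι (A ⊗[F] A) :=
    fun i j => Coalgebra.comul (R := F) (HopfAlgebra.antipode F (c i j))
  let Y : Matrix ι ι (A ⊗[F] A) :=
    fun i j => ∑ l, HopfAlgebra.antipode F (c l j) ⊗ₜ[F] HopfAlgebra.antipode F (c i l)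
  have h1 : M * X = 1 := by
    ext i j
    rw [Matrix.mul_apply, Matrix.one_apply]
    show ∑ l, Coalgebra.comul (R := F) (c i l) *
      Coalgebra.comul (R := F) (HopfAlgebra.antipode F (c l j)) = _
    simp only [← Bialgebra.comul_mul, ← map_sum, h.mul_S]
    split_ifs <;> simp
  have h2 : Y * M = 1 := by
    ext i j
    rw [Matrix.mul_apply, Matrix.one_apply]
    show ∑ m, (∑ l, HopfAlgebra.antipode F (c l m) ⊗ₜ[F] HopfAlgebra.antipode F (c i l)) *
      Coalgebra.comul (R := F) (c m j) = _
    simp only [h.1, Finset.sum_mul_sum, Algebra.TensorProduct.tmul_mul_tmul]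
    calc ∑ m, ∑ l, ∑ p, (HopfAlgebra.antipode F (c l m) * c m p) ⊗ₜ[F]
            (HopfAlgebra.antipode F (c i l) * c p j)
        = ∑ l, ∑ p, (∑ m, HopfAlgebra.antipode F (c l m) * c m p) ⊗ₜ[F]
            (HopfAlgebra.antipode F (c i l) * c p j) := by
          rw [Finset.sum_comm]
          refine Finset.sum_congr rfl fun l _ => ?_
          rw [Finset.sum_comm]
          simp only [TensorProduct.sum_tmul]
      _ = (1 : A) ⊗ₜ[F] (∑ l, HopfAlgebra.antipode F (c i l) * c l j) := by
          rw [TensorProduct.tmul_sum]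
          refine Finset.sum_congr rfl fun l _ => ?_
          rw [Finset.sum_eq_single l]
          · simp [h.S_mul]
          · intro b _ hb; simp [h.S_mul, hb.symm]
          · simp
      _ = _ := by
          rw [h.S_mul]; split_ifs <;> simp [Algebra.TensorProduct.one_def]
  have h3 : X = Y := (left_inv_eq_right_inv h2 h1).symm
  exact congrFun (congrFun h3 i) j

theorem IsMM.St (h : IsMM F c) :
    IsMM F (fun i j => HopfAlgebra.antipode F (c j i) : Matrix ι ι A) := by
  constructor
  · intro i j
    exact h.comul_S j i
  · intro i j
    simp only [HopfAlgebra.counit_antipode, h.2, eq_comm]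

theorem IsMM.S2 (h : IsMM F c) :
    IsMM F (fun i j => HopfAlgebra.antipode F (HopfAlgebra.antipode F (c i j)) : Matrix ι ι A) :=
  h.St.St
end mm

section structureA
variable {F A : Type*} [Field F] [Ring A] [HopfAlgebra F A]

theorem conv_app (f g : WithConv (A →ₗ[F] F)) (h : A) :
    (f * g).ofConv h = f.ofConv (slR g.ofConv (Coalgebra.comul (R := F) h)) := by
  rw [← mul_map_eq]; rfl

theorem rho_mul (f g : WithConv (A →ₗ[F] F)) (h : A) :
    slR (f * g).ofConv (Coalgebra.comul (R := F) h) =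
      slR f.ofConv (Coalgebra.comul (R := F) (slR g.ofConv (Coalgebra.comul (R := F) h))) := by
  refine dual_ext (F := F) fun e => ?_
  have h1 := conv_app (WithConv.toConv e) (f * g) h
  have h2 := conv_app (WithConv.toConv e) f (slR g.ofConv (Coalgebra.comul (R := F) h))
  have h3 := conv_app (WithConv.toConv e * f) g h
  rw [mul_assoc] at h3
  exact h1.symm.trans (h3.trans h2)

theorem rho_counit (h : A) :
    slR (Coalgebra.counit (R := F)) (Coalgebra.comul (R := F) h) = h := by
  have := Coalgebra.lTensor_counit_comul (R := F) h
  have h2 : slR (Coalgebra.counit (R := F) (A := A)) (Coalgebra.comul (R := F) h) =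
    TensorProduct.rid F A ((LinearMap.lTensor A (Coalgebra.counit (R := F))) (Coalgebra.comul (R := F) h)) := rfl
  rw [h2, this]; simp

theorem lam_counit (h : A) :
    slL (Coalgebra.counit (R := F)) (Coalgebra.comul (R := F) h) = h := by
  have := Coalgebra.rTensor_counit_comul (R := F) h
  have h2 : slL (Coalgebra.counit (R := F) (A := A)) (Coalgebra.comul (R := F) h) =
    TensorProduct.lid F A ((LinearMap.rTensor A (Coalgebra.counit (R := F))) (Coalgebra.comul (R := F) h)) := rfl
  rw [h2, this]; simp

theorem exists_p (F R : Type*) [Field F] [IsAlgClosed F] [Ring R] [Algebra F R]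
    [FiniteDimensional F R] :
    ∃ (m : ℕ) (d : Fin m → ℕ) (p : R →ₐ[F] ((α : Fin m) → Matrix (Fin (d α)) (Fin (d α)) F))
      (J : Ideal R), (∀ α, NeZero (d α)) ∧ Function.Surjective p ∧ J.IsTwoSided ∧
      IsNilpotent J ∧ ∀ f, f ∈ J ↔ p f = 0 := by
  haveI : IsArtinianRing R := IsArtinianRing.of_finite F R
  obtain ⟨m, d, hd, ⟨e⟩⟩ :=
    IsSemisimpleRing.exists_algEquiv_pi_matrix_of_isAlgClosed F (R ⧸ Ring.jacobson R)
  refine ⟨m, d, e.toAlgHom.comp (Ideal.Quotient.mkₐ F (Ring.jacobson R)), Ring.jacobson R, hd,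
    ?_, inferInstance, IsSemiprimaryRing.isNilpotent, ?_⟩
  · exact e.surjective.comp (Ideal.Quotient.mkₐ_surjective F _)
  · intro f
    rw [← Ideal.Quotient.eq_zero_iff_mem]
    simp

variable [FiniteDimensional F A]

/-- coefficient data for the coradical -/
structure CD (F A : Type*) [Field F] [Ring A] [HopfAlgebra F A] where
  m : ℕ
  d : Fin m → ℕ
  c : (α : Fin m) → Matrix (Fin (d α)) (Fin (d α)) A
  mm : ∀ α, IsMM F (c α)
  li : LinearIndependent F (fun s : Σ α : Fin m, Fin (d α) × Fin (d α) => c s.1 s.2.1 s.2.2)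
  sp : Submodule.span F (Set.range
    (fun s : Σ α : Fin m, Fin (d α) × Fin (d α) => c s.1 s.2.1 s.2.2)) = coradical F A

theorem exists_pre [IsAlgClosed F] :
    ∃ (m : ℕ) (d : Fin m → ℕ) (c : (α : Fin m) → Matrix (Fin (d α)) (Fin (d α)) A)
      (J : Ideal (WithConv (A →ₗ[F] F))), (∀ α, IsMM F (c α)) ∧
      LinearIndependent F (fun s : Σ α : Fin m, Fin (d α) × Fin (d α) => c s.1 s.2.1 s.2.2) ∧
      J.IsTwoSided ∧ IsNilpotent J ∧ (∀ α, NeZero (d α)) ∧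
      ∀ f, f ∈ J ↔ ∀ α i j, f.ofConv (c α i j) = 0 := by
  haveI : FiniteDimensional F (WithConv (A →ₗ[F] F)) :=
    LinearEquiv.finiteDimensional (WithConv.linearEquiv F (A →ₗ[F] F)).symm
  obtain ⟨m, d, p, J, hd, hp, hJ2, hJn, hJ⟩ := exists_p F (WithConv (A →ₗ[F] F))
  let φ : (α : Fin m) → Fin (d α) → Fin (d α) → Module.Dual F (Module.Dual F A) := fun α i j =>
    { toFun := fun f => p (WithConv.toConv f) α i j
      map_add' := fun f g => by rw [WithConv.toConv_add, map_add]; rfl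
      map_smul' := fun t f => by rw [WithConv.toConv_smul, map_smul]; rfl }
  let c : (α : Fin m) → Matrix (Fin (d α)) (Fin (d α)) A := fun α i j =>
    (Module.evalEquiv F A).symm (φ α i j)
  have hc : ∀ (f : A →ₗ[F] F) α i j, f (c α i j) = p (WithConv.toConv f) α i j := by
    intro f α i j
    exact Module.apply_evalEquiv_symm_apply F A f (φ α i j)
  refine ⟨m, d, c, J, ?_, ?_, hJ2, hJn, hd, ?_⟩
  · intro α
    constructor
    · intro i j
      refine slR_ext fun g => dual_ext (F := F) fun f => ?_
      have h1 := conv_app (WithConv.toConv f) (WithConv.toConv g) (c α i j)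
      refine h1.symm.trans ?_
      rw [hc]
      simp only [map_sum, slR_tmul, map_smul]
      simp only [hc, WithConv.toConv_ofConv]
      rw [map_mul, Pi.mul_apply, Matrix.mul_apply]
      simp [mul_comm]
    · intro i j
      rw [hc]
      have : WithConv.toConv (Coalgebra.counit (R := F) (A := A)) = 1 := rfl
      rw [this, map_one]
      simp [Matrix.one_apply]
  · rw [Fintype.linearIndependent_iff]
    rintro g hg ⟨α, i, j⟩
    obtain ⟨f, hf⟩ := hp (Pi.single α (Matrix.single i j 1))
    have := congrArg f.ofConv hg
    simp only [map_sum, map_smul, hc, WithConv.toConv_ofConv, hf, map_zero] at this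
    rw [Finset.sum_eq_single ⟨α, i, j⟩] at this
    · simpa using this
    · rintro ⟨β, a, b⟩ _ hne
      by_cases h : β = α
      · subst h
        have : ¬ (i = a ∧ j = b) := by
          rintro ⟨rfl, rfl⟩; exact hne rfl
        simp [Matrix.single, this]
      · simp [Pi.single_eq_of_ne h]
    · simp
  · intro f
    rw [hJ]
    constructor
    · intro h α i j
      rw [hc, WithConv.toConv_ofConv, h]; rfl
    · intro h
      funext α
      ext i j
      have := h α i j
      rwa [hc, WithConv.toConv_ofConv] at this
end structureA

section structureB
variable {F A : Type*} [Field F] [Ring A] [HopfAlgebra F A]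

theorem dual_fam {ι : Type*} [Fintype ι] [DecidableEq ι] {v : ι → A}
    (h : LinearIndependent F v) :
    ∃ e : ι → (A →ₗ[F] F), ∀ s t, e s (v t) = if s = t then 1 else 0 := by
  obtain ⟨g, hg⟩ := (Fintype.linearCombination F v).exists_leftInverse_of_injective
    (LinearMap.ker_eq_bot.2 (linearIndependent_iff_injective_fintypeLinearCombination.1 h))
  refine ⟨fun s => LinearMap.proj s ∘ₗ g, fun s t => ?_⟩
  have := LinearMap.congr_fun hg (Pi.single t 1)
  rw [LinearMap.comp_apply, Fintype.linearCombination_apply_single, one_smul] at this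
  rw [LinearMap.comp_apply, this]
  simp [Pi.single_apply]

section
variable {ι : Type*} [Fintype ι] [DecidableEq ι] {c : Matrix ι ι A}

theorem IsMM.slL (h : IsMM F c) (f : A →ₗ[F] F) (i j : ι) :
    slL f (Coalgebra.comul (R := F) (c i j)) = ∑ l, f (c i l) • c l j := by
  rw [h.1, map_sum]; simp only [slL_tmul]

theorem IsMM.slR (h : IsMM F c) (f : A →ₗ[F] F) (i j : ι) :
    slR f (Coalgebra.comul (R := F) (c i j)) = ∑ l, f (c l j) • c i l := by
  rw [h.1, map_sum]; simp only [slR_tmul]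
end

variable [FiniteDimensional F A]

theorem IsMM.simple {r : ℕ} [NeZero r] {c : Matrix (Fin r) (Fin r) A} (h : IsMM F c)
    (hli : LinearIndependent F (fun q : Fin r × Fin r => c q.1 q.2)) :
    IsSimpleSubcoalg F A (Submodule.span F (Set.range fun q : Fin r × Fin r => c q.1 q.2)) := by
  have hmem : ∀ i j, c i j ∈ Submodule.span F (Set.range fun q : Fin r × Fin r => c q.1 q.2) :=
    fun i j => Submodule.subset_span ⟨(i, j), rfl⟩
  refine ⟨?_, ?_, ?_⟩
  · intro hb
    have := hmem 0 0
    rw [hb, Submodule.mem_bot] at this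
    exact hli.ne_zero (0, 0) this
  · rw [isSubcoalg_iff]
    intro s hs f
    induction hs using Submodule.span_induction with
    | mem x hx =>
      obtain ⟨⟨i, j⟩, rfl⟩ := hx
      dsimp only
      rw [h.slL, h.slR]
      exact ⟨Submodule.sum_mem _ fun l _ => Submodule.smul_mem _ _ (hmem _ _),
        Submodule.sum_mem _ fun l _ => Submodule.smul_mem _ _ (hmem _ _)⟩
    | zero => simp
    | add x y _ _ hx hy =>
      simp only [map_add]
      exact ⟨Submodule.add_mem _ hx.1 hy.1, Submodule.add_mem _ hx.2 hy.2⟩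
    | smul a x _ hx =>
      simp only [map_smul]
      exact ⟨Submodule.smul_mem _ _ hx.1, Submodule.smul_mem _ _ hx.2⟩
  · intro T hT hTs
    rw [isSubcoalg_iff] at hTs
    by_cases hb : T = ⊥
    · exact .inl hb
    right
    refine le_antisymm hT ?_
    obtain ⟨t, htT, ht0⟩ := Submodule.exists_mem_ne_zero_of_ne_bot hb
    obtain ⟨a, ha⟩ := (Submodule.mem_span_range_iff_exists_fun F).1 (hT htT)
    obtain ⟨e, he⟩ := dual_fam hli
    have : ∃ q, a q ≠ 0 := by
      by_contra hcon
      push Not at hcon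
      apply ht0
      rw [← ha]; simp [hcon]
    obtain ⟨⟨p, q⟩, hpq⟩ := this
    rw [Submodule.span_le]
    rintro _ ⟨⟨l, m⟩, rfl⟩
    have h1 : ∑ j, a (p, j) • c l j ∈ T := by
      have := (hTs t htT (e (p, l))).1
      rw [← ha] at this
      convert this using 1
      symm
      rw [map_sum, map_sum, Fintype.sum_prod_type, Finset.sum_eq_single p]
      · refine Finset.sum_congr rfl fun j _ => ?_
        rw [map_smul, map_smul, h.slL, Finset.sum_eq_single l]
        · have := he (p, l) (p, l)
          simp at this
          simp [this]
        · intro b _ hb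
          have := he (p, l) (p, b)
          simp [hb.symm] at this
          simp [this]
        · simp
      · intro b _ hb
        refine Finset.sum_eq_zero fun j _ => ?_
        rw [map_smul, map_smul, h.slL, Finset.sum_eq_zero, smul_zero]
        intro x _
        have := he (p, l) (b, x)
        simp [hb.symm] at this
        simp [this]
      · simp
    have h2 : a (p, q) • c l m ∈ T := by
      have := (hTs _ h1 (e (m, q))).2
      convert this using 1
      rw [map_sum, map_sum, Finset.sum_eq_single q]
      · rw [map_smul, map_smul, h.slR, Finset.sum_eq_single m]
        · have := he (m, q) (m, q)
          simp at this
          simp [this]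
        · intro b _ hb
          have := he (m, q) (b, q)
          simp [hb.symm] at this
          simp [this]
        · simp
      · intro b _ hb
        rw [map_smul, map_smul, h.slR, Finset.sum_eq_zero, smul_zero]
        intro x _
        have := he (m, q) (x, b)
        simp [hb.symm] at this
        simp [this]
      · simp
    have := T.smul_mem (a (p, q))⁻¹ h2
    rwa [smul_smul, inv_mul_cancel₀ hpq, one_smul] at this

theorem exists_CD [IsAlgClosed F] : ∃ D : CD F A, coradical F A ≠ ⊤ →
    ∃ v, v ∉ coradical F A ∧ ∀ f : A →ₗ[F] F, (∀ a ∈ coradical F A, f a = 0) →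
      slR f (Coalgebra.comul (R := F) v) ∈ coradical F A := by
  obtain ⟨m, d, c, J, mm, li, hJ2, hJn, hd, hJ⟩ := exists_pre (F := F) (A := A)
  have hsp : Submodule.span F (Set.range
    (fun s : Σ α : Fin m, Fin (d α) × Fin (d α) => c s.1 s.2.1 s.2.2)) = coradical F A := by
    apply le_antisymm
    · rw [Submodule.span_le]
      rintro _ ⟨⟨α, i, j⟩, rfl⟩
      have hli : LinearIndependent F (fun q : Fin (d α) × Fin (d α) => c α q.1 q.2) :=
        li.comp (fun q => (⟨α, q⟩ : Σ α : Fin m, Fin (d α) × Fin (d α))) (fun x y h => by simpa using h)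
      have := (mm α).simple hli
      have h2 := le_sSup (show _ ∈ {S : Submodule F A | IsSimpleSubcoalg F A S} from this)
      exact h2 (Submodule.subset_span ⟨(i, j), rfl⟩)
    · apply sSup_le
      intro S hS
      set D := Submodule.span F (Set.range
        (fun s : Σ α : Fin m, Fin (d α) × Fin (d α) => c s.1 s.2.1 s.2.2)) with hD
      have hmem : ∀ α i j, c α i j ∈ D := fun α i j => Submodule.subset_span ⟨⟨α, i, j⟩, rfl⟩
      have hDs : IsSubcoalg F A D := by
        rw [isSubcoalg_iff]
        intro s hs f
        induction hs using Submodule.span_induction with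
        | mem x hx =>
          obtain ⟨⟨α, i, j⟩, rfl⟩ := hx
          dsimp only
          rw [(mm α).slL, (mm α).slR]
          exact ⟨Submodule.sum_mem _ fun l _ => Submodule.smul_mem _ _ (hmem _ _ _),
            Submodule.sum_mem _ fun l _ => Submodule.smul_mem _ _ (hmem _ _ _)⟩
        | zero => simp
        | add x y _ _ hx hy =>
          simp only [map_add]
          exact ⟨Submodule.add_mem _ hx.1 hy.1, Submodule.add_mem _ hx.2 hy.2⟩
        | smul a x _ hx =>
          simp only [map_smul]
          exact ⟨Submodule.smul_mem _ _ hx.1, Submodule.smul_mem _ _ hx.2⟩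
      obtain ⟨hS0, hSs, hSm⟩ := hS
      rw [isSubcoalg_iff] at hDs hSs
      have hI : IsSubcoalg F A (S ⊓ D) := by
        rw [isSubcoalg_iff]
        intro s hs f
        exact ⟨⟨(hSs s hs.1 f).1, (hDs s hs.2 f).1⟩, ⟨(hSs s hs.1 f).2, (hDs s hs.2 f).2⟩⟩
      rcases hSm _ inf_le_left hI with h | h
      · exfalso
        have h1 := Subspace.dualAnnihilator_inf_eq S D
        rw [h, Submodule.dualAnnihilator_bot] at h1
        have h2 : (Coalgebra.counit (R := F) (A := A)) ∈ S.dualAnnihilator ⊔ D.dualAnnihilator := by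
          rw [← h1]; trivial
        obtain ⟨a, ha, b, hb, hab⟩ := Submodule.mem_sup.1 h2
        rw [Submodule.mem_dualAnnihilator] at ha hb
        have hbJ : WithConv.toConv b ∈ J := by
          rw [hJ]; intro α i j; exact hb _ (hmem α i j)
        have hbn : IsNilpotent (WithConv.toConv b) := by
          obtain ⟨n, hn⟩ := hJn
          refine ⟨n, ?_⟩
          have := Ideal.pow_mem_pow hbJ n
          rw [hn] at this
          simpa using this
        have hau : IsUnit (WithConv.toConv a) := by
          have : WithConv.toConv a = 1 - WithConv.toConv b := by
            rw [eq_sub_iff_add_eq, ← WithConv.toConv_add, hab]; rfl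
          rw [this]
          exact hbn.isUnit_one_sub
        obtain ⟨u, hu⟩ := hau.exists_left_inv
        have key : ∀ g : A →ₗ[F] F, (∀ w ∈ S, g w = 0) → ∀ s ∈ S,
            slR g (Coalgebra.comul (R := F) s) = 0 := by
          intro g hg s hs
          refine dual_ext (F := F) fun f => ?_
          rw [sl_comm, map_zero]
          exact hg _ (hSs s hs f).1
        have hε : ∀ s ∈ S, Coalgebra.counit (R := F) s = 0 := by
          intro s hs
          have h3 := conv_app u (WithConv.toConv a) s
          rw [hu] at h3
          have h4 : slR a (Coalgebra.comul (R := F) s) = 0 := key a ha s hs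
          change Coalgebra.counit (R := F) s = u.ofConv (slR a (Coalgebra.comul (R := F) s)) at h3
          rw [h3, h4, map_zero]
        apply hS0
        rw [Submodule.eq_bot_iff]
        intro s hs
        rw [← rho_counit (F := F) s]
        exact key _ hε s hs
      · exact inf_eq_left.1 h
  refine ⟨⟨m, d, c, mm, li, hsp⟩, ?_⟩
  intro htop
  by_contra hcon
  push Not at hcon
  obtain ⟨v0, -, hv0⟩ := SetLike.exists_of_lt (lt_top_iff_ne_top.2 htop)
  have : ∀ n, ∃ f ∈ J ^ n, slR f.ofConv (Coalgebra.comul (R := F) v0) ∉ coradical F A := by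
    intro n
    induction n with
    | zero =>
      refine ⟨1, by rw [Submodule.pow_zero, Ideal.one_eq_top]; trivial, ?_⟩
      have : slR (1 : WithConv (A →ₗ[F] F)).ofConv (Coalgebra.comul (R := F) v0) = v0 :=
        rho_counit (F := F) v0
      rwa [this]
    | succ n ih =>
      obtain ⟨f, hf, hfv⟩ := ih
      obtain ⟨g, hg, hgv⟩ := hcon _ hfv
      refine ⟨WithConv.toConv g * f, ?_, ?_⟩
      · rw [Ideal.IsTwoSided.pow_succ]
        refine Ideal.mul_mem_mul ?_ hf
        rw [hJ]
        intro α i j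
        apply hg
        rw [← hsp]
        exact Submodule.subset_span ⟨⟨α, i, j⟩, rfl⟩
      · rw [rho_mul]; exact hgv
  obtain ⟨n, hn⟩ := hJn
  obtain ⟨f, hf, hfv⟩ := this n
  rw [hn] at hf
  have hf0 : f = 0 := by simpa using hf
  apply hfv
  rw [hf0]
  have : slR (0 : WithConv (A →ₗ[F] F)).ofConv (Coalgebra.comul (R := F) v0) = 0 := slR_zero _
  rw [this]; exact Submodule.zero_mem _
end structureB

section partC
variable {F A : Type*} [Field F] [Ring A] [HopfAlgebra F A]

/-- index type -/
abbrev CD.I (D : CD F A) : Type := Σ α : Fin D.m, Fin (D.d α) × Fin (D.d α)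

/-- the coefficients as one family -/
def CD.b (D : CD F A) (s : D.I) : A := D.c s.1 s.2.1 s.2.2

theorem CD.b_mem (D : CD F A) (s : D.I) : D.b s ∈ coradical F A := by
  rw [← D.sp]; exact Submodule.subset_span ⟨s, rfl⟩

theorem CD.c_mem (D : CD F A) (α i j) : D.c α i j ∈ coradical F A := D.b_mem ⟨α, i, j⟩

/-- dual functionals -/
def CD.e (D : CD F A) : D.I → (A →ₗ[F] F) := Classical.choose (dual_fam D.li)

theorem CD.e_b (D : CD F A) (s t : D.I) : D.e s (D.b t) = if s = t then 1 else 0 :=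
  Classical.choose_spec (dual_fam D.li) s t

theorem CD.expand (D : CD F A) {a : A} (ha : a ∈ coradical F A) :
    a = ∑ s, D.e s a • D.b s := by
  rw [← D.sp] at ha
  obtain ⟨g, hg⟩ := (Submodule.mem_span_range_iff_exists_fun F).1 ha
  change ∑ s, g s • D.b s = a at hg
  rw [← hg]
  refine Finset.sum_congr rfl fun s _ => ?_
  simp [D.e_b]

theorem CD.sum_I {M : Type*} [AddCommMonoid M] (D : CD F A) (f : D.I → M) :
    ∑ s, f s = ∑ α, ∑ i, ∑ j, f ⟨α, i, j⟩ := by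
  rw [Fintype.sum_sigma]
  refine Finset.sum_congr rfl fun α _ => ?_
  rw [Fintype.sum_prod_type]

theorem CD.e_c (D : CD F A) (α β : Fin D.m) (i j a b) :
    D.e ⟨α, i, j⟩ (D.c β a b) = if (⟨α, i, j⟩ : D.I) = ⟨β, a, b⟩ then 1 else 0 :=
  D.e_b ⟨α, i, j⟩ ⟨β, a, b⟩

theorem CD.e_c_same (D : CD F A) (α : Fin D.m) (i j a b) :
    D.e ⟨α, i, j⟩ (D.c α a b) = if i = a ∧ j = b then 1 else 0 := by
  rw [D.e_c]; simp

theorem CD.e_c_ne (D : CD F A) {α β : Fin D.m} (h : α ≠ β) (i j a b) :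
    D.e ⟨α, i, j⟩ (D.c β a b) = 0 := by
  rw [D.e_c, if_neg]
  intro h'
  exact h (congrArg Sigma.fst h')

theorem lam_rho (f g : A →ₗ[F] F) (h : A) :
    slR g (Coalgebra.comul (R := F) (slL f (Coalgebra.comul (R := F) h))) =
      slL f (Coalgebra.comul (R := F) (slR g (Coalgebra.comul (R := F) h))) := by
  refine dual_ext (F := F) fun f' => ?_
  have h1 := conv_app (WithConv.toConv f) (WithConv.toConv f' * WithConv.toConv g) h
  have h2 := conv_app (WithConv.toConv f * WithConv.toConv f') (WithConv.toConv g) h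
  have h3 := conv_app (WithConv.toConv f') (WithConv.toConv g)
    (slL f (Coalgebra.comul (R := F) h))
  have h4 := conv_app (WithConv.toConv f) (WithConv.toConv f')
    (slR g (Coalgebra.comul (R := F) h))
  rw [mul_assoc] at h2
  rw [sl_comm] at h1
  rw [← sl_comm f f']
  exact h3.symm.trans (h1.symm.trans (h2.trans h4))

/-- tensors with all right slices in the coradical -/
def Lsub (F A : Type*) [Field F] [Ring A] [HopfAlgebra F A] : Submodule F (A ⊗[F] A) :=
  ⨅ f : A →ₗ[F] F, (coradical F A).comap (slR f)

theorem mem_Lsub {z : A ⊗[F] A} : z ∈ Lsub F A ↔ ∀ f : A →ₗ[F] F, slR f z ∈ coradical F A := by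
  simp [Lsub, Submodule.mem_iInf]

theorem Lsub_mul (hm : ∀ a ∈ coradical F A, ∀ b ∈ coradical F A, a * b ∈ coradical F A)
    {z : A ⊗[F] A} (hz : z ∈ Lsub F A) {a : A} (ha : a ∈ coradical F A) (b : A) :
    z * (a ⊗ₜ[F] b) ∈ Lsub F A := by
  rw [mem_Lsub] at hz ⊢
  intro f
  have : slR f (z * (a ⊗ₜ[F] b)) = slR (f ∘ₗ LinearMap.mulRight F b) z * a := by
    clear hz
    induction z with
    | zero => simp
    | tmul x y => simp [slR_tmul]
    | add x y hx hy => simp only [map_add, add_mul, hx, hy]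
  rw [this]
  exact hm _ (hz _) _ ha

variable [FiniteDimensional F A]

theorem partC1 (D : CD F A)
    (hm : ∀ a ∈ coradical F A, ∀ b ∈ coradical F A, a * b ∈ coradical F A)
    (hs : ∀ a ∈ coradical F A, HopfAlgebra.antipode F a ∈ coradical F A)
    (v : A) (hv : v ∉ coradical F A)
    (hv2 : ∀ f : A →ₗ[F] F, (∀ a ∈ coradical F A, f a = 0) →
      slR f (Coalgebra.comul (R := F) v) ∈ coradical F A) :
    ∃ y, y ∉ coradical F A ∧ Coalgebra.comul (R := F) y - y ⊗ₜ[F] (1 : A) ∈ Lsub F A := by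
  set V : D.I → A := fun s => slR (D.e s) (Coalgebra.comul (R := F) v) with hV
  have h1 : ∀ f : A →ₗ[F] F, slR f (Coalgebra.comul (R := F) v) - ∑ s, f (D.b s) • V s
      ∈ coradical F A := by
    intro f
    have := hv2 (f - ∑ s, f (D.b s) • D.e s) (by
      intro a ha
      rw [D.expand ha]
      simp only [LinearMap.sub_apply, map_sum, map_smul, LinearMap.sum_apply, LinearMap.smul_apply,
        D.e_b]
      simp [mul_comm])
    rw [slR_sub, slR_sum] at this
    simpa only [slR_smul] using this
  have h2 : ∃ α j, V ⟨α, j, j⟩ ∉ coradical F A := by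
    by_contra hcon
    push Not at hcon
    apply hv
    have := h1 (Coalgebra.counit (R := F))
    rw [rho_counit] at this
    have h3 : ∑ s, Coalgebra.counit (R := F) (D.b s) • V s ∈ coradical F A := by
      refine Submodule.sum_mem _ ?_
      rintro ⟨α, i, j⟩ _
      have : Coalgebra.counit (R := F) (D.b ⟨α, i, j⟩) = if i = j then (1 : F) else 0 :=
        (D.mm α).2 i j
      rw [this]
      split_ifs with hij
      · subst hij; rw [one_smul]; exact hcon α i
      · simp
    have := Submodule.add_mem _ this h3
    simpa using this
  obtain ⟨α, j, hj⟩ := h2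
  set w : Fin (D.d α) → A := fun l => V ⟨α, l, j⟩ with hw
  have hmm := D.mm α
  have h3 : ∀ l, Coalgebra.comul (R := F) (w l) - ∑ a, w a ⊗ₜ[F] D.c α a l ∈ Lsub F A := by
    intro l
    rw [mem_Lsub]
    intro g
    have h4 := h1 (WithConv.toConv g * WithConv.toConv (D.e ⟨α, l, j⟩)).ofConv
    rw [rho_mul] at h4
    rw [map_sub, map_sum]
    convert h4 using 2
    rw [D.sum_I]
    simp only [slR_tmul]
    have key : ∀ β a b, (WithConv.toConv g * WithConv.toConv (D.e ⟨α, l, j⟩)).ofConv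
        (D.b ⟨β, a, b⟩) = ∑ x, D.e ⟨α, l, j⟩ (D.c β x b) * g (D.c β a x) := by
      intro β a b
      rw [conv_app]
      change g (slR (D.e ⟨α, l, j⟩) (Coalgebra.comul (R := F) (D.c β a b))) = _
      rw [(D.mm β).slR]; simp
    rw [Finset.sum_eq_single α]
    · refine Finset.sum_congr rfl fun a _ => ?_
      rw [Finset.sum_eq_single j]
      · rw [key, Finset.sum_eq_single l]
        · rw [D.e_c_same]; simp [hw]
        · intro x _ hx
          rw [D.e_c_same]; simp [hx.symm]
        · simp
      · intro b _ hb
        rw [key, Finset.sum_eq_zero, zero_smul]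
        intro x _
        rw [D.e_c_same]; simp [hb.symm]
      · simp
    · intro β _ hβ
      refine Finset.sum_eq_zero fun a _ => Finset.sum_eq_zero fun b _ => ?_
      rw [key, Finset.sum_eq_zero, zero_smul]
      intro x _
      rw [D.e_c_ne hβ.symm, zero_mul]
    · simp
  set y : Fin (D.d α) → A := fun l => ∑ i, w i * HopfAlgebra.antipode F (D.c α i l) with hy
  have h4 : ∃ l, y l ∉ coradical F A := by
    by_contra hcon
    push Not at hcon
    apply hj
    change w j ∈ _
    have : w j = ∑ i, y i * D.c α i j := by
      simp only [hy, Finset.sum_mul, mul_assoc]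
      rw [Finset.sum_comm]
      simp only [← Finset.mul_sum, hmm.S_mul]
      simp
    rw [this]
    exact Submodule.sum_mem _ fun i _ => hm _ (hcon i) _ (D.c_mem _ _ _)
  obtain ⟨l, hl⟩ := h4
  refine ⟨y l, hl, ?_⟩
  have h5 : Coalgebra.comul (R := F) (y l) - y l ⊗ₜ[F] (1 : A) =
      ∑ i, ∑ m, (Coalgebra.comul (R := F) (w i) - ∑ a, w a ⊗ₜ[F] D.c α a i) *
        (HopfAlgebra.antipode F (D.c α m l) ⊗ₜ[F] HopfAlgebra.antipode F (D.c α i m)) := by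
    simp only [sub_mul, Finset.sum_sub_distrib]
    congr 1
    · simp only [hy, map_sum, Bialgebra.comul_mul, hmm.comul_S, Finset.mul_sum]
    · simp only [Finset.sum_mul, Algebra.TensorProduct.tmul_mul_tmul]
      rw [Finset.sum_comm]
      have : ∀ m a, ∑ i, (w a * HopfAlgebra.antipode F (D.c α m l)) ⊗ₜ[F]
          (D.c α a i * HopfAlgebra.antipode F (D.c α i m)) =
          if a = m then (w a * HopfAlgebra.antipode F (D.c α m l)) ⊗ₜ[F] (1 : A) else 0 := by
        intro m a
        rw [← TensorProduct.tmul_sum, hmm.mul_S]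
        split_ifs <;> simp
      have h6 : ∀ m, ∑ i, ∑ a, (w a * HopfAlgebra.antipode F (D.c α m l)) ⊗ₜ[F]
          (D.c α a i * HopfAlgebra.antipode F (D.c α i m)) =
          (w m * HopfAlgebra.antipode F (D.c α m l)) ⊗ₜ[F] (1 : A) := by
        intro m
        rw [Finset.sum_comm]
        simp only [this]
        simp
      simp only [h6, hy, TensorProduct.sum_tmul]
  rw [h5]
  exact Submodule.sum_mem _ fun i _ => Submodule.sum_mem _ fun m _ =>
    Lsub_mul hm (h3 i) (hs _ (D.c_mem _ _ _)) _

theorem partC2 (D : CD F A) (h1 : (1 : A) ∈ coradical F A) (y : A) (hy : y ∉ coradical F A)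
    (hL : Coalgebra.comul (R := F) y - y ⊗ₜ[F] (1 : A) ∈ Lsub F A) :
    ∃ (α : Fin D.m) (x : Fin (D.d α) → A), (∀ j, Coalgebra.comul (R := F) (x j) =
      (∑ l, D.c α j l ⊗ₜ[F] x l) + x j ⊗ₜ[F] (1 : A)) ∧ ∃ j, x j ∉ coradical F A := by
  set z : D.I → A := fun s => slL (D.e s) (Coalgebra.comul (R := F) y - y ⊗ₜ[F] (1 : A)) with hz
  have hΔ : Coalgebra.comul (R := F) y - y ⊗ₜ[F] (1 : A) = ∑ s, D.b s ⊗ₜ[F] z s := by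
    refine slR_ext fun f => ?_
    rw [D.expand (mem_Lsub.1 hL f), map_sum]
    refine Finset.sum_congr rfl fun s _ => ?_
    rw [sl_comm, slR_tmul]
  have hΔ' : Coalgebra.comul (R := F) y = y ⊗ₜ[F] (1 : A) + ∑ s, D.b s ⊗ₜ[F] z s := by
    rw [← hΔ]; abel
  have hz2 : ∀ s, slL (D.e s) (Coalgebra.comul (R := F) y) = z s + D.e s y • 1 := by
    intro s
    simp [hz, slL_tmul]
  have hρ : ∀ g : A →ₗ[F] F, slR g (Coalgebra.comul (R := F) y) =
      g 1 • y + ∑ t, g (z t) • D.b t := by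
    intro g
    rw [hΔ', map_add, map_sum]
    simp [slR_tmul]
  have hzΔ : ∀ α i j, Coalgebra.comul (R := F) (z ⟨α, i, j⟩) =
      (∑ l, D.c α j l ⊗ₜ[F] z ⟨α, i, l⟩) + z ⟨α, i, j⟩ ⊗ₜ[F] (1 : A) := by
    intro α i j
    refine slR_ext fun g => ?_
    have e1 := lam_rho (D.e ⟨α, i, j⟩) g y
    rw [hz2, hρ] at e1
    simp only [map_add, map_smul, map_sum, Bialgebra.comul_one, hz2] at e1
    have e2 : slR g (1 : A ⊗[F] A) = g 1 • (1 : A) := by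
      rw [Algebra.TensorProduct.one_def, slR_tmul]
    rw [e2] at e1
    have e3 : ∑ t, g (z t) • slL (D.e ⟨α, i, j⟩) (Coalgebra.comul (R := F) (D.b t)) =
        ∑ l, g (z ⟨α, i, l⟩) • D.c α j l := by
      have key : ∀ β a b, slL (D.e ⟨α, i, j⟩) (Coalgebra.comul (R := F) (D.b ⟨β, a, b⟩)) =
          ∑ x, D.e ⟨α, i, j⟩ (D.c β a x) • D.c β x b := fun β a b => (D.mm β).slL _ _ _
      rw [D.sum_I, Finset.sum_eq_single α]
      · rw [Finset.sum_eq_single i]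
        · refine Finset.sum_congr rfl fun b _ => ?_
          rw [key, Finset.sum_eq_single j]
          · rw [D.e_c_same]; simp
          · intro x _ hx
            rw [D.e_c_same]; simp [hx.symm]
          · simp
        · intro a _ ha
          refine Finset.sum_eq_zero fun b _ => ?_
          rw [key, Finset.sum_eq_zero, smul_zero]
          intro x _
          rw [D.e_c_same]; simp [ha.symm]
        · simp
      · intro β _ hβ
        refine Finset.sum_eq_zero fun a _ => Finset.sum_eq_zero fun b _ => ?_
        rw [key, Finset.sum_eq_zero, smul_zero]
        intro x _
        rw [D.e_c_ne hβ.symm, zero_smul]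
      · simp
    rw [e3] at e1
    simp only [map_add, map_sum, slR_tmul]
    have e4 : D.e ⟨α, i, j⟩ y • g 1 • (1 : A) = g 1 • D.e ⟨α, i, j⟩ y • (1 : A) := smul_comm _ _ _
    rw [smul_add, e4] at e1
    have e5 := sub_eq_zero.2 e1
    rw [← sub_eq_zero, ← e5]
    abel
  have hex : ∃ α i, z ⟨α, i, i⟩ ∉ coradical F A := by
    by_contra hcon
    push Not at hcon
    apply hy
    have h3 : ∑ s, Coalgebra.counit (R := F) (D.b s) • z s ∈ coradical F A := by
      refine Submodule.sum_mem _ ?_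
      rintro ⟨α, i, j⟩ _
      have : Coalgebra.counit (R := F) (D.b ⟨α, i, j⟩) = if i = j then (1 : F) else 0 :=
        (D.mm α).2 i j
      rw [this]
      split_ifs with hij
      · subst hij; rw [one_smul]; exact hcon α i
      · simp
    have e1 := lam_counit (F := F) y
    rw [hΔ', map_add, map_sum] at e1
    simp only [slL_tmul] at e1
    rw [← e1]
    exact Submodule.add_mem _ (Submodule.smul_mem _ _ h1) h3
  obtain ⟨α, i, hi⟩ := hex
  exact ⟨α, fun j => z ⟨α, i, j⟩, fun j => hzΔ α i j, i, hi⟩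
end partC

section partC3
variable {F A : Type*} [Field F] [Ring A] [HopfAlgebra F A]

/-- `(a ⊗ b) x = a x S(b)` -/
def adT (F A : Type*) [Field F] [Ring A] [HopfAlgebra F A] : A ⊗[F] A →ₗ[F] Module.End F A :=
  TensorProduct.lift (LinearMap.mk₂ F
    (fun a b => LinearMap.mulLeft F a ∘ₗ LinearMap.mulRight F (HopfAlgebra.antipode F b))
    (fun a a' b => by ext x; simp [add_mul])
    (fun t a b => by ext x; simp)
    (fun a b b' => by ext x; simp [mul_add])
    (fun t a b => by ext x; simp))

theorem adT_tmul (a b x : A) :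
    adT F A (a ⊗ₜ[F] b) x = a * (x * HopfAlgebra.antipode F b) := by
  simp [adT]

theorem adT_mul (z w : A ⊗[F] A) (x : A) : adT F A (z * w) x = adT F A z (adT F A w x) := by
  induction z with
  | zero => simp
  | add z z' hz hz' => simp only [add_mul, map_add, LinearMap.add_apply, hz, hz']
  | tmul a b =>
    induction w with
    | zero => simp
    | add z z' hz hz' => simp only [mul_add, map_add, LinearMap.add_apply, hz, hz']
    | tmul a' b' =>
      simp [adT_tmul, HopfAlgebra.antipode_mul_antidistrib, mul_assoc]

/-- the adjoint action -/
def ad (F : Type*) {A : Type*} [Field F] [Ring A] [HopfAlgebra F A] (h : A) : Module.End F A :=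
  adT F A (Coalgebra.comul (R := F) h)

theorem ad_mul (g h x : A) : ad F (g * h) x = ad F g (ad F h x) := by
  simp only [ad, Bialgebra.comul_mul, adT_mul]

theorem ad_one (x : A) : ad F (1 : A) x = x := by
  rw [ad, Bialgebra.comul_one, Algebra.TensorProduct.one_def, adT_tmul]
  simp

theorem ad_sum {ι : Type*} (s : Finset ι) (h : ι → A) (x : A) :
    ad F (∑ i ∈ s, h i) x = ∑ i ∈ s, ad F (h i) x := by
  simp [ad, map_sum]

theorem ad_zero (x : A) : ad F (0 : A) x = 0 := by simp [ad]

/-- S² -/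
def Q2 (F A : Type*) [Field F] [Ring A] [HopfAlgebra F A] : Module.End F A :=
  HopfAlgebra.antipode F ∘ₗ HopfAlgebra.antipode F

theorem Q2_apply (a : A) : Q2 F A a = HopfAlgebra.antipode F (HopfAlgebra.antipode F a) := rfl

section
variable {ι : Type*} [Fintype ι] [DecidableEq ι] {c : Matrix ι ι A}

/-- primitive columns -/
def IsPrim (F : Type*) {A : Type*} [Field F] [Ring A] [HopfAlgebra F A] {ι : Type*} [Fintype ι]
    (c : Matrix ι ι A) (x : ι → A) : Prop :=
  ∀ i, Coalgebra.comul (R := F) (x i) = (∑ l, c i l ⊗ₜ[F] x l) + x i ⊗ₜ[F] (1 : A)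

/-- block matrix -/
def blk (c : Matrix ι ι A) (x : ι → A) : Matrix (ι ⊕ Unit) (ι ⊕ Unit) A
  | Sum.inl i, Sum.inl j => c i j
  | Sum.inl i, Sum.inr _ => x i
  | Sum.inr _, Sum.inl _ => 0
  | Sum.inr _, Sum.inr _ => 1

theorem IsPrim.block (hc : IsMM F c) {x : ι → A} (hx : IsPrim F c x) :
    IsMM F (blk c x) := by
  have hε : ∀ i, Coalgebra.counit (R := F) (x i) = 0 := by
    intro i
    have := lam_counit (F := F) (x i)
    rw [hx i, map_add, map_sum] at this
    simp only [slL_tmul, hc.2] at this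
    simp only [ite_smul, one_smul, zero_smul, Finset.sum_ite_eq, Finset.mem_univ, if_true,
      add_eq_left] at this
    have h2 := congrArg (Coalgebra.counit (R := F)) this
    simpa using h2
  constructor
  · rintro (i | i) (j | j)
    · simp [blk, hc.1]
    · simp [blk, hx i]
    · simp [blk]
    · simp [blk, Algebra.TensorProduct.one_def]
  · rintro (i | i) (j | j)
    · simp [blk, hc.2]
    · simp [blk, hε]
    · simp [blk]
    · simp [blk]

theorem IsPrim.Q (hc : IsMM F c) (hQ : ∀ i j, Q2 F A (c i j) = c i j) {x : ι → A}
    (hx : IsPrim F c x) : IsPrim F c (fun i => Q2 F A (x i)) := by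
  intro i
  have := (hx.block hc).S2.1 (Sum.inl i) (Sum.inr ())
  simp only [Fintype.sum_sum_type, blk] at this
  simp only [← Q2_apply, hQ] at this
  rw [this]
  simp [Q2_apply]

theorem IsPrim.S (hc : IsMM F c) {x : ι → A} (hx : IsPrim F c x) (i : ι) :
    HopfAlgebra.antipode F (x i) = - ∑ l, HopfAlgebra.antipode F (c i l) * x l := by
  have := (hx.block hc).S_mul (Sum.inl i) (Sum.inr ())
  simp only [Fintype.sum_sum_type, blk] at this
  simp at this
  rw [eq_neg_iff_add_eq_zero, add_comm]
  exact this

theorem IsPrim.Q_eq_ad (hc : IsMM F c) {x : ι → A} (hx : IsPrim F c x) (i : ι) :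
    Q2 F A (x i) = ∑ l, ad F (HopfAlgebra.antipode F (c i l)) (x l) := by
  rw [Q2_apply, hx.S hc, map_neg, map_sum]
  simp only [HopfAlgebra.antipode_mul_antidistrib, hx.S hc, ad, hc.comul_S, map_sum,
    LinearMap.sum_apply, adT_tmul]
  rw [Finset.sum_comm, ← Finset.sum_neg_distrib]
  refine Finset.sum_congr rfl fun l _ => ?_
  rw [neg_mul, neg_neg, Finset.sum_mul]
  simp only [mul_assoc]

theorem IsPrim.Q_pow (hc : IsMM F c) (hQ : ∀ i j, Q2 F A (c i j) = c i j) {x : ι → A}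
    (hx : IsPrim F c x) (n : ℕ) : IsPrim F c (fun i => (Q2 F A ^ n) (x i)) ∧
    ∀ i, (Q2 F A ^ n) (x i) = ∑ l, ad F (((Matrix.of fun i j =>
      HopfAlgebra.antipode F (c i j)) ^ n : Matrix ι ι A) i l) (x l) := by
  induction n with
  | zero =>
    refine ⟨by simpa using hx, fun i => ?_⟩
    rw [Finset.sum_eq_single i]
    · simp [ad_one]
    · intro b _ hb
      simp [Matrix.one_apply, hb.symm, ad_zero]
    · simp
  | succ n ih =>
    obtain ⟨h1, h2⟩ := ih
    have h3 : ∀ i, (Q2 F A ^ (n + 1)) (x i) = Q2 F A ((Q2 F A ^ n) (x i)) := by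
      intro i; rw [pow_succ']; rfl
    refine ⟨?_, fun i => ?_⟩
    · simp only [h3]
      exact h1.Q hc hQ
    · rw [h3, h1.Q_eq_ad hc]
      simp only [h2, map_sum, ← ad_mul]
      rw [Finset.sum_comm]
      refine Finset.sum_congr rfl fun l _ => ?_
      rw [← ad_sum, pow_succ', Matrix.mul_apply]
      rfl

theorem IsPrim.Q_pow_N (hc : IsMM F c) (hQ : ∀ i j, Q2 F A (c i j) = c i j) {x : ι → A}
    (hx : IsPrim F c x) {N : ℕ} (hN : c ^ N = 1) (i : ι) : (Q2 F A ^ N) (x i) = x i := by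
  set D : Matrix ι ι A := Matrix.of fun i j => HopfAlgebra.antipode F (c i j) with hD
  have h1 : D * c = 1 := by
    ext i j; rw [Matrix.mul_apply, Matrix.one_apply]; exact hc.S_mul i j
  have h2 : c * D = 1 := by
    ext i j; rw [Matrix.mul_apply, Matrix.one_apply]; exact hc.mul_S i j
  have h3 : D ^ N = 1 := by
    have : Commute D c := h1.trans h2.symm
    have h4 := this.mul_pow N
    rw [h1, one_pow, hN, mul_one] at h4
    exact h4.symm
  rw [(hx.Q_pow hc hQ N).2 i, h3, Finset.sum_eq_single i]
  · simp [ad_one]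
  · intro b _ hb
    simp [Matrix.one_apply, hb.symm, ad_zero]
  · simp

theorem IsPrim.sum {κ : Type*} (s : Finset κ) (t : κ → F) {x : κ → ι → A}
    (hx : ∀ a, IsPrim F c (x a)) : IsPrim F c (fun i => ∑ a ∈ s, t a • x a i) := by
  intro i
  rw [map_sum]
  simp only [map_smul, hx _ i, smul_add, Finset.sum_add_distrib, TensorProduct.sum_tmul,
    TensorProduct.tmul_sum, TensorProduct.smul_tmul', TensorProduct.tmul_smul, Finset.smul_sum]
  rw [Finset.sum_comm]

theorem partC3 [IsAlgClosed F] [CharZero F] (hc : IsMM F c)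
    (hQ : ∀ i j, Q2 F A (c i j) = c i j) {x : ι → A}
    (hx : IsPrim F c x) {N : ℕ} (hN0 : 0 < N) (hN : c ^ N = 1)
    (hn : ∃ i, x i ∉ coradical F A) :
    ∃ (x' : ι → A) (q : F), IsPrim F c x' ∧ (∃ i, x' i ∉ coradical F A) ∧ q ^ N = 1 ∧
      ∀ i, Q2 F A (x' i) = q • x' i := by
  haveI : NeZero N := ⟨hN0.ne'⟩
  obtain ⟨ω, hω⟩ := HasEnoughRootsOfUnity.exists_primitiveRoot F N
  let X : ℕ → ι → A := fun a i => ∑ j ∈ Finset.range N, (ω ^ a) ^ j • (Q2 F A ^ j) (x i)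
  have hXp : ∀ a, IsPrim F c (X a) := fun a =>
    IsPrim.sum _ _ (fun j => (hx.Q_pow hc hQ j).1)
  have hω0 : ω ≠ 0 := hω.ne_zero hN0.ne'
  have hXQ : ∀ a i, (ω ^ a) • Q2 F A (X a i) = X a i := by
    intro a i
    have e1 := Finset.sum_range_succ (fun j => (ω ^ a) ^ j • (Q2 F A ^ j) (x i)) N
    have e2 := Finset.sum_range_succ' (fun j => (ω ^ a) ^ j • (Q2 F A ^ j) (x i)) N
    rw [hx.Q_pow_N hc hQ hN, ← pow_mul, mul_comm a, pow_mul, hω.pow_eq_one] at e1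
    rw [e1] at e2
    simp only [one_pow, pow_zero, Module.End.one_apply] at e2
    have e3 := add_right_cancel e2
    have e4 : X a i = ∑ j ∈ Finset.range N, (ω ^ a) ^ (j + 1) • (Q2 F A ^ (j + 1)) (x i) := e3
    rw [e4]
    rw [← e3, map_sum, Finset.smul_sum, e3]
    refine Finset.sum_congr rfl fun j _ => ?_
    rw [map_smul, smul_smul, pow_succ', pow_succ']; rfl
  have hsum : ∀ i, ∑ a ∈ Finset.range N, X a i = (N : F) • x i := by
    intro i
    simp only [X]
    rw [Finset.sum_comm]
    simp only [← Finset.sum_smul]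
    rw [Finset.sum_eq_single 0]
    · simp
    · intro j hj hj0
      have h1 : ω ^ j ≠ 1 := hω.pow_ne_one_of_pos_of_lt hj0 (Finset.mem_range.1 hj)
      have h2 := mul_geom_sum (ω ^ j) N
      rw [← pow_mul, mul_comm j, pow_mul, hω.pow_eq_one, one_pow, sub_self] at h2
      have h3 := (mul_eq_zero.1 h2).resolve_left (sub_ne_zero.2 h1)
      have h4 : ∑ a ∈ Finset.range N, (ω ^ a) ^ j = 0 := by
        rw [← h3]; refine Finset.sum_congr rfl fun a _ => ?_
        rw [← pow_mul, ← pow_mul, mul_comm]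
      rw [h4, zero_smul]
    · intro h; exact absurd (Finset.mem_range.2 hN0) h
  obtain ⟨i, hi⟩ := hn
  have hex : ∃ a, X a i ∉ coradical F A := by
    by_contra hcon
    push Not at hcon
    apply hi
    have h1 := Submodule.sum_mem (coradical F A) (fun a (_ : a ∈ Finset.range N) => hcon a)
    rw [hsum] at h1
    have h2 := Submodule.smul_mem _ (N : F)⁻¹ h1
    rwa [smul_smul, inv_mul_cancel₀ (by exact_mod_cast hN0.ne'), one_smul] at h2
  obtain ⟨a, ha⟩ := hex
  refine ⟨X a, (ω ^ a)⁻¹, hXp a, ⟨i, ha⟩, ?_, fun l => ?_⟩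
  · rw [inv_pow, ← pow_mul, mul_comm a, pow_mul, hω.pow_eq_one, one_pow, inv_one]
  · rw [eq_inv_smul_iff₀ (pow_ne_zero _ hω0)]
    exact hXQ a l
end
end partC3

section partB0
variable {F A : Type*} [Field F] [Ring A] [HopfAlgebra F A]
variable {ι : Type*} [Fintype ι] [DecidableEq ι] {c : Matrix ι ι A}

/-- the twisted matrix powers -/
def Mpow (T : A →ₐ[F] A) (c : Matrix ι ι A) : ℕ → Matrix ι ι A
  | 0 => 1
  | n + 1 => c * T.mapMatrix (Mpow T c n)

theorem Mpow_succ' (T : A →ₐ[F] A) (c : Matrix ι ι A) (n : ℕ) :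
    Mpow T c (n + 1) = Mpow T c n * (T.mapMatrix)^[n] c := by
  induction n with
  | zero => simp [Mpow]
  | succ n ih =>
    rw [Mpow, ih, map_mul, ← mul_assoc, Function.iterate_succ_apply', ← ih]
    rfl

theorem convSeq_eq (T : A →ₐ[F] A) (hc : IsMM F c) (n k : ℕ) (i j : ι) :
    convSeq F A (fun m => T.toLinearMap ^ (m + k)) n (c i j) =
      (T.toLinearMap ^ k) (Mpow T c n i j) := by
  have hmul : ∀ (k : ℕ) (a b : A), (T.toLinearMap ^ k) (a * b) =
      (T.toLinearMap ^ k) a * (T.toLinearMap ^ k) b := by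
    intro k
    induction k with
    | zero => simp
    | succ k ih => intro a b; simp [pow_succ', ih]
  have hone : ∀ (k : ℕ), (T.toLinearMap ^ k) 1 = 1 := by
    intro k
    induction k with
    | zero => simp
    | succ k ih => simp [pow_succ', ih]
  induction n generalizing k i j with
  | zero =>
    simp only [convSeq, convOne, LinearMap.comp_apply, hc.2, Mpow, Matrix.one_apply]
    split_ifs <;> simp [hone]
  | succ n ih =>
    have h1 : convSeq F A (fun m => T.toLinearMap ^ (m + k)) (n + 1) =
      conv F A (T.toLinearMap ^ k) (convSeq F A (fun m => T.toLinearMap ^ (m + (k + 1))) n) := by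
      rw [convSeq]
      congr 2
      · simp
      · funext m; congr 1; ring
    rw [h1]
    simp only [conv, LinearMap.comp_apply, hc.1, map_sum, TensorProduct.map_tmul,
      LinearMap.mul'_apply, ih]
    rw [Mpow, Matrix.mul_apply, map_sum]
    refine Finset.sum_congr rfl fun l _ => ?_
    rw [hmul, pow_succ]
    rfl

theorem twistPow_eq (T : A →ₐ[F] A) (hc : IsMM F c) (n : ℕ) (i j : ι) :
    twistPow F A T.toLinearMap n (c i j) = Mpow T c n i j := by
  have := convSeq_eq T hc n 0 i j
  simpa [twistPow] using this

theorem twist_fix (T : A →ₐ[F] A) (hc : IsMM F c) {N : ℕ}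
    (hN : ∀ i j, twistPow F A T.toLinearMap N (c i j) =
      algebraMap F A (Coalgebra.counit (R := F) (c i j))) :
    Mpow T c N = 1 ∧ ∀ i j, T^[N] (c i j) = c i j := by
  have h1 : Mpow T c N = 1 := by
    ext i j
    rw [← twistPow_eq T hc, hN, hc.2, Matrix.one_apply]
    split_ifs <;> simp
  refine ⟨h1, ?_⟩
  have h2 : Mpow T c (N + 1) = c := by rw [Mpow, h1]; simp
  rw [Mpow_succ', h1, one_mul] at h2
  have h3 : ∀ n, ∀ i j, ((T.mapMatrix)^[n] c) i j = T^[n] (c i j) := by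
    intro n
    induction n with
    | zero => simp
    | succ n ih =>
      intro i j
      rw [Function.iterate_succ_apply', Function.iterate_succ_apply', ← ih]; rfl
  intro i j
  rw [← h3, h2]

theorem Mpow_of_fix (T : A →ₐ[F] A) (hT : ∀ i j, T (c i j) = c i j) (n : ℕ) :
    Mpow T c n = c ^ n := by
  have h0 : T.mapMatrix c = c := by ext i j; exact hT i j
  induction n with
  | zero => rfl
  | succ n ih => rw [pow_succ', Mpow, ih, map_pow, h0]

/-- S² as an algebra map -/
def QA (F A : Type*) [Field F] [Ring A] [HopfAlgebra F A] : A →ₐ[F] A :=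
  AlgHom.ofLinearMap (Q2 F A) (by simp [Q2_apply]) (by
    intro a b; simp [Q2_apply, HopfAlgebra.antipode_mul_antidistrib])

theorem QA_apply (a : A) : QA F A a = Q2 F A a := rfl

/-- S⁻² as an algebra map -/
theorem exists_TA (Sinv : Module.End F A)
    (hS1 : Sinv ∘ₗ HopfAlgebra.antipode (R := F) (A := A) = LinearMap.id)
    (hS2 : HopfAlgebra.antipode (R := F) (A := A) ∘ₗ Sinv = LinearMap.id) :
    ∃ T : A →ₐ[F] A, T.toLinearMap = Sinv ∘ₗ Sinv ∧ (∀ a, T (Q2 F A a) = a) ∧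
      ∀ a, Q2 F A (T a) = a := by
  have h1 : ∀ a, Sinv (HopfAlgebra.antipode F a) = a := fun a => LinearMap.congr_fun hS1 a
  have h2 : ∀ a, HopfAlgebra.antipode F (Sinv a) = a := fun a => LinearMap.congr_fun hS2 a
  have h3 : Sinv 1 = 1 := by
    have := h1 1
    rwa [HopfAlgebra.antipode_one] at this
  have h4 : ∀ a b, Sinv (a * b) = Sinv b * Sinv a := by
    intro a b
    have := h1 (Sinv b * Sinv a)
    rwa [HopfAlgebra.antipode_mul_antidistrib, h2, h2] at this
  refine ⟨AlgHom.ofLinearMap (Sinv ∘ₗ Sinv) (by simp [h3]) (by intro a b; simp [h4]), ?_, ?_, ?_⟩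
  · ext a; rfl
  · intro a; simp [Q2_apply, h1]
  · intro a; simp [Q2_apply, h2]

theorem Q_pow_of_T (T : A →ₐ[F] A) (h : ∀ a, Q2 F A (T a) = a) {N : ℕ} {a : A}
    (hT : T^[N] a = a) : (Q2 F A ^ N) a = a := by
  have : ∀ n, (Q2 F A ^ n) (T^[n] a) = a := by
    intro n
    induction n with
    | zero => simp
    | succ n ih => rw [Function.iterate_succ_apply', pow_succ, Module.End.mul_apply, h, ih]
  have h2 := this N
  rwa [hT] at h2
end partB0

section arith
variable {F V : Type*} [Field F] [IsAlgClosed F] [CharZero F] [AddCommGroup V] [Module F V]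
  [FiniteDimensional F V]

theorem eig_basis {N : ℕ} (hN : 0 < N) {ζ : F} (hζ : IsPrimitiveRoot ζ N) (A : Module.End F V)
    (hA : A ^ N = 1) : ∃ (n : Fin (Module.finrank F V) → ℕ)
      (b : Module.Basis (Fin (Module.finrank F V)) F V), ∀ i, A (b i) = ζ ^ (n i) • b i := by
  have hss : A.IsSemisimple := by
    refine Module.End.isSemisimple_of_squarefree_aeval_eq_zero
      (p := Polynomial.X ^ N - 1) ?_ (by simp [hA])
    have : (Polynomial.X ^ N - 1 : Polynomial F).Separable := by
      have := Polynomial.separable_X_pow_sub_C (F := F) (n := N) 1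
        (by exact_mod_cast hN.ne') one_ne_zero
      simpa using this
    exact this.squarefree
  have htop := hss.iSup_eigenspace_eq_top
  set s : Set V := {v | ∃ n : ℕ, A v = ζ ^ n • v} with hs
  have hspan : ⊤ ≤ Submodule.span F s := by
    rw [← htop]
    refine iSup_le fun μ => ?_
    intro v hv
    rw [Module.End.mem_eigenspace_iff] at hv
    by_cases hv0 : v = 0
    · rw [hv0]; exact zero_mem _
    · have hp : ∀ j, (A ^ j) v = μ ^ j • v := by
        intro j
        induction j with
        | zero => simp
        | succ j ih => rw [pow_succ', Module.End.mul_apply, ih, map_smul, hv, smul_smul, pow_succ]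
      have h1 : μ ^ N = 1 := by
        have h2 := hp N
        rw [hA, Module.End.one_apply] at h2
        have h3 : (μ ^ N - 1) • v = 0 := by rw [sub_smul, ← h2, one_smul, sub_self]
        rcases smul_eq_zero.mp h3 with h | h
        · exact sub_eq_zero.mp h
        · exact absurd h hv0
      haveI : NeZero N := ⟨hN.ne'⟩
      obtain ⟨i, -, hi⟩ := hζ.eq_pow_of_pow_eq_one h1
      exact Submodule.subset_span ⟨i, by rw [hi, hv]⟩
  let b0 := Module.Basis.ofSpan hspan
  have hb0 : ∀ i, b0 i ∈ s := fun i => Module.Basis.ofSpan_subset hspan ⟨i, rfl⟩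
  haveI := Module.Finite.finite_basis b0
  haveI := Fintype.ofFinite (((linearIndepOn_empty F id).extend (Set.empty_subset s)) : Set V)
  let e := Fintype.equivFinOfCardEq (Module.finrank_eq_card_basis b0).symm
  choose n hn using hb0
  refine ⟨fun i => n (e.symm i), b0.reindex e, fun i => ?_⟩
  rw [Module.Basis.reindex_apply, hn]

theorem trace_eig {ι : Type*} [Fintype ι] [DecidableEq ι] (b : Module.Basis ι F V)
    (A : Module.End F V) (t : ι → F) (h : ∀ i, A (b i) = t i • b i) :
    LinearMap.trace F V A = ∑ i, t i := by
  rw [LinearMap.trace_eq_matrix_trace F b]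
  simp [Matrix.trace, LinearMap.toMatrix_apply, h]

theorem trace_eig_pow {ι : Type*} [Fintype ι] [DecidableEq ι] (b : Module.Basis ι F V)
    (A : Module.End F V) (t : ι → F) (h : ∀ i, A (b i) = t i • b i) (j : ℕ) :
    LinearMap.trace F V (A ^ j) = ∑ i, t i ^ j := by
  refine trace_eig b _ _ fun i => ?_
  induction j with
  | zero => simp
  | succ j ih => rw [pow_succ', Module.End.mul_apply, ih, map_smul, h, smul_smul, pow_succ]

theorem unit_sum_eq {ι : Type*} [Fintype ι] (z : ι → ℂ) (hz : ∀ i, ‖z i‖ = 1)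
    (hs : ‖∑ i, z i‖ = Fintype.card ι) : ∀ i j, z i = z j := by
  classical
  intro i0 j0
  haveI : Nonempty ι := ⟨i0⟩
  have hd : (0 : ℝ) < Fintype.card ι := by exact_mod_cast Fintype.card_pos
  set s := ∑ i, z i with hsd
  set w := (starRingEnd ℂ) s / (Fintype.card ι : ℂ) with hw
  have hwn : ‖w‖ = 1 := by
    rw [hw, norm_div, RCLike.norm_conj, hs]; simp
  have hsum : ∑ i, (w * z i).re = ∑ i : ι, (1 : ℝ) := by
    rw [← Complex.re_sum, ← Finset.mul_sum, ← hsd, hw, div_mul_eq_mul_div,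
      mul_comm, Complex.mul_conj, Complex.normSq_eq_norm_sq, hs]
    have : (((Fintype.card ι : ℝ) ^ 2 : ℝ) : ℂ) / (Fintype.card ι : ℂ) = ((Fintype.card ι : ℝ) : ℂ) := by
      have h0 : (Fintype.card ι : ℂ) ≠ 0 := by exact_mod_cast hd.ne'
      push_cast
      field_simp
    rw [this]; simp
  have hle : ∀ i ∈ Finset.univ, (w * z i).re ≤ 1 := fun i _ => by
    refine (Complex.re_le_norm _).trans ?_
    rw [norm_mul, hwn, hz, one_mul]
  have heq := (Finset.sum_eq_sum_iff_of_le hle).mp hsum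
  have h1 : ∀ i, w * z i = 1 := fun i => by
    have hr := heq i (Finset.mem_univ i)
    have hnn : ‖w * z i‖ = 1 := by rw [norm_mul, hwn, hz, one_mul]
    have : (w * z i).re ^ 2 + (w * z i).im ^ 2 = 1 := by
      have := Complex.normSq_eq_norm_sq (w * z i)
      rw [hnn, Complex.normSq_apply] at this
      linarith
    rw [hr] at this
    have him : (w * z i).im = 0 := by nlinarith
    apply Complex.ext <;> simp [hr, him]
  have hw0 : w ≠ 0 := by intro h; rw [h] at hwn; simp at hwn
  exact mul_left_cancel₀ hw0 ((h1 i0).trans (h1 j0).symm)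

/-- common number-theoretic data -/
theorem cyc_data (F : Type*) [Field F] [IsAlgClosed F] [CharZero F] {N : ℕ} (hN : 0 < N) :
    ∃ (K : Type) (_ : Field K) (_ : NumberField K) (ι : K →+* F) (z : K) (_ : K →+* ℂ),
      IsPrimitiveRoot z N ∧ IsPrimitiveRoot (ι z) N := by
  haveI : NeZero N := ⟨hN.ne'⟩
  haveI : NeZero (N : ℚ) := ⟨by exact_mod_cast hN.ne'⟩
  have hz : ∃ z : CyclotomicField N ℚ, IsPrimitiveRoot z N := by
    have h := CyclotomicField.isCyclotomicExtension N ℚ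
    exact h.exists_isPrimitiveRoot rfl hN.ne'
  obtain ⟨z, hz⟩ := hz
  letI : Algebra ℚ F := DivisionRing.toRatAlgebra
  let ι : CyclotomicField N ℚ →ₐ[ℚ] F := IsAlgClosed.lift
  obtain ⟨φ⟩ : Nonempty (CyclotomicField N ℚ →+* ℂ) := inferInstance
  exact ⟨_, _, inferInstance, ι.toRingHom, z, φ, hz, hz.map_of_injective ι.injective⟩

theorem trace_integral {N : ℕ} (M : Module.End F V) (hM : M ^ (N + 1) = M) (hN : 0 < N) :
    IsIntegral ℤ (LinearMap.trace F V M) := by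
  rw [Module.End.trace_eq_sum_roots_charpoly_of_splits (IsAlgClosed.splits _)]
  refine IsIntegral.multiset_sum fun μ hμ => ?_
  have hr := Polynomial.isRoot_of_mem_roots hμ
  rw [← Module.End.hasEigenvalue_iff_isRoot_charpoly] at hr
  obtain ⟨v, hv⟩ := hr.exists_hasEigenvector
  have hp := hv.pow_apply (N + 1)
  rw [hM, hv.apply_eq_smul] at hp
  have : μ ^ (N + 1) = μ := by
    have h3 : (μ ^ (N + 1) - μ) • v = 0 := by rw [sub_smul, ← hp, sub_self]
    rcases smul_eq_zero.mp h3 with h | h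
    · exact sub_eq_zero.mp h
    · exact absurd h hv.2
  by_cases h0 : μ = 0
  · rw [h0]; exact isIntegral_zero
  · have : μ ^ N = 1 := by
      rw [pow_succ] at this
      exact mul_right_cancel₀ h0 (by rw [this, one_mul])
    exact IsIntegral.of_pow hN (this ▸ isIntegral_one)

theorem scalar_of_trace {N : ℕ} (hN : 0 < N) (Q E : Module.End F V) (hQ : Q ^ N = 1)
    (hE : E * E = E) (hEQ : E * Q = Q * E)
    (ht : LinearMap.trace F V Q = (Module.finrank F V : F) * LinearMap.trace F V (E * Q))
    (h0 : LinearMap.trace F V Q ≠ 0) : ∃ μ : F, ∀ v, Q v = μ • v := by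
  obtain ⟨K, _, _, ι, z, φ, hz, hιz⟩ := cyc_data F hN
  set d := Module.finrank F V with hd
  obtain ⟨n, b, hb⟩ := eig_basis hN hιz Q hQ
  have htr := trace_eig b Q _ hb
  have hintegral : IsIntegral ℤ (LinearMap.trace F V (E * Q)) := by
    refine trace_integral (N := N) _ ?_ hN
    have hc : Commute E Q := hEQ
    rw [hc.mul_pow, pow_succ Q, hQ, one_mul]
    have : IsIdempotentElem E := hE
    rw [this.pow_succ_eq N]
  have hd0 : (d : F) ≠ 0 := by
    intro h; rw [h, zero_mul] at ht; exact h0 ht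
  have hdn : d ≠ 0 := by intro h; rw [h] at hd0; simp at hd0
  set a : K := (∑ i, z ^ n i) / d with ha
  have hιa : ι a = LinearMap.trace F V (E * Q) := by
    rw [ha, map_div₀, map_sum, map_natCast, div_eq_iff hd0, mul_comm, ← ht, htr]
    simp
  have ha0 : a ≠ 0 := by
    intro h; rw [h, map_zero] at hιa; rw [← hιa, mul_zero] at ht; exact h0 ht
  have hai : IsIntegral ℤ a := by
    rw [← hιa] at hintegral
    exact (isIntegral_algHom_iff (ι.toIntAlgHom) ι.injective).mp hintegral
  have hunit : ∀ (φ : K →+* ℂ) (i : Fin d), ‖φ (z ^ n i)‖ = 1 := fun φ i => by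
    have : ‖φ z‖ = 1 := by
      refine Complex.norm_eq_one_of_pow_eq_one (n := N) ?_ hN.ne'
      rw [← map_pow, hz.pow_eq_one, map_one]
    rw [map_pow, norm_pow, this, one_pow]
  have hle : ∀ φ : K →+* ℂ, ‖φ a‖ ≤ 1 := fun φ => by
    rw [ha, map_div₀, map_sum, map_natCast, norm_div]
    have h1 : ‖∑ i, φ (z ^ n i)‖ ≤ d := by
      refine (norm_sum_le _ _).trans ?_
      simp [hunit, -map_pow, hd]
    rw [Complex.norm_natCast]
    exact div_le_one_of_le₀ h1 (by positivity)
  obtain ⟨m, hm0, hm⟩ := NumberField.Embeddings.pow_eq_one_of_norm_le_one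
    K ℂ ha0 hai hle
  have hφa : ‖φ a‖ = 1 := by
    refine Complex.norm_eq_one_of_pow_eq_one (n := m) ?_ hm0.ne'
    rw [← map_pow, hm, map_one]
  have hs : ‖∑ i, φ (z ^ n i)‖ = Fintype.card (Fin d) := by
    rw [ha, map_div₀, map_sum, map_natCast, norm_div, Complex.norm_natCast] at hφa
    rw [Fintype.card_fin]
    rwa [div_eq_one_iff_eq (by exact_mod_cast hdn)] at hφa
  have heq := unit_sum_eq _ (hunit φ) hs
  let i0 : Fin d := ⟨0, Nat.pos_of_ne_zero hdn⟩
  refine ⟨ι z ^ n i0, fun v => ?_⟩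
  have : Q = (ι z ^ n i0) • (1 : Module.End F V) := by
    refine b.ext fun i => ?_
    rw [hb, LinearMap.smul_apply, Module.End.one_apply]
    have := φ.injective (heq i i0)
    rw [← map_pow, ← map_pow, this]
  rw [this]; rfl

/-- the nonnegative elements of `F` relative to chosen embeddings -/
def PosEl {K : Type*} [Field K] (ι : K →+* F) (φ : K →+* ℂ) (x : F) : Prop :=
  ∃ y : K, ι y = x ∧ ∃ r : ℝ, 0 ≤ r ∧ φ y = r

theorem PosEl.sum {K : Type*} [Field K] {ι : K →+* F} {φ : K →+* ℂ} {I : Type*} (s : Finset I)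
    (f : I → F) (hf : ∀ i ∈ s, PosEl ι φ (f i)) : PosEl ι φ (∑ i ∈ s, f i) := by
  classical
  induction s using Finset.induction_on with
  | empty => exact ⟨0, by simp, 0, le_rfl, by simp⟩
  | insert i s hi ih =>
    rw [Finset.sum_insert hi]
    obtain ⟨y, hy, r, hr, hyr⟩ := hf i (Finset.mem_insert_self _ _)
    obtain ⟨y', hy', r', hr', hyr'⟩ := ih fun j hj => hf j (Finset.mem_insert_of_mem hj)
    exact ⟨y + y', by rw [map_add, hy, hy'], r + r', by positivity, by
      rw [map_add, hyr, hyr']; push_cast; rfl⟩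

theorem PosEl.one_add_ne {K : Type*} [Field K] {ι : K →+* F} {φ : K →+* ℂ} {x : F}
    (hx : PosEl ι φ x) : 1 + x ≠ 0 := by
  obtain ⟨y, hy, r, hr, hyr⟩ := hx
  intro h
  have h1 : ι (1 + y) = ι 0 := by rw [map_add, map_one, hy, h, map_zero]
  have h2 := congrArg φ (ι.injective h1)
  rw [map_add, map_one, hyr, map_zero] at h2
  have : (1 + r : ℝ) = 0 := by exact_mod_cast h2
  linarith

theorem posEl_trace {N : ℕ} (hN : 0 < N) {K : Type*} [Field K] {ι : K →+* F} {φ : K →+* ℂ} {z : K}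
    (hz : IsPrimitiveRoot z N)
    (hιz : IsPrimitiveRoot (ι z) N) (A : Module.End F V) (hA : A ^ N = 1) :
    PosEl ι φ (LinearMap.trace F V A * LinearMap.trace F V (A ^ (N - 1))) := by
  obtain ⟨n, b, hb⟩ := eig_basis hN hιz A hA
  rw [trace_eig_pow b A _ hb, trace_eig b A _ hb]
  refine ⟨(∑ i, z ^ n i) * (∑ i, (z ^ n i) ^ (N - 1)), by simp,
    Complex.normSq (∑ i, φ z ^ n i), Complex.normSq_nonneg _, ?_⟩
  rw [← Complex.mul_conj]
  simp only [map_mul, map_sum, map_pow]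
  congr 1
  refine Finset.sum_congr rfl fun i _ => ?_
  rw [← pow_mul, mul_comm, pow_mul]
  congr 1
  have h1 : φ z ^ N = 1 := by rw [← map_pow, hz.pow_eq_one, map_one]
  have hn : ‖φ z‖ = 1 := Complex.norm_eq_one_of_pow_eq_one h1 hN.ne'
  have h0 : φ z ≠ 0 := by intro h; rw [h] at hn; simp at hn
  have h2 : φ z * (starRingEnd ℂ) (φ z) = 1 := by
    rw [Complex.mul_conj, Complex.normSq_eq_norm_sq, hn]; simp
  have h3 : φ z * φ z ^ (N - 1) = 1 := by
    rw [← pow_succ', Nat.sub_add_cancel hN, h1]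
  exact mul_left_cancel₀ h0 (h3.trans h2.symm)
end arith

section partB
variable {F A : Type*} [Field F] [Ring A] [HopfAlgebra F A]

/-- the matrix of the comodule `H₀` -/
def CD.l (D : CD F A) : Matrix D.I D.I A := fun s t => slR (D.e t) (Coalgebra.comul (R := F) (D.b s))

theorem CD.slR_b (D : CD F A) (f : A →ₗ[F] F) (α i j) :
    slR f (Coalgebra.comul (R := F) (D.b ⟨α, i, j⟩)) = ∑ m, f (D.c α m j) • D.c α i m :=
  (D.mm α).slR f i j

theorem CD.slR_b_zero (D : CD F A) (f : A →ₗ[F] F) (hf : ∀ s, f (D.b s) = 0) (s : D.I) :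
    slR f (Coalgebra.comul (R := F) (D.b s)) = 0 := by
  obtain ⟨α, i, j⟩ := s
  rw [D.slR_b]
  refine Finset.sum_eq_zero fun m _ => ?_
  rw [show f (D.c α m j) = 0 from hf ⟨α, m, j⟩, zero_smul]

theorem CD.slR_l (D : CD F A) (f : A →ₗ[F] F) (s : D.I) :
    slR f (Coalgebra.comul (R := F) (D.b s)) = ∑ v, f (D.b v) • D.l s v := by
  have h := D.slR_b_zero (f - ∑ v, f (D.b v) • D.e v) (fun t => by
    simp only [LinearMap.sub_apply, LinearMap.sum_apply, LinearMap.smul_apply, D.e_b]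
    simp) s
  rw [slR_sub, slR_sum, sub_eq_zero] at h
  rw [h]
  exact Finset.sum_congr rfl fun v _ => slR_smul _ _ _

theorem CD.l_mem (D : CD F A) (s t : D.I) : D.l s t ∈ coradical F A := by
  obtain ⟨α, i, j⟩ := s
  rw [CD.l, D.slR_b]
  exact Submodule.sum_mem _ fun m _ => Submodule.smul_mem _ _ (D.c_mem _ _ _)

theorem CD.l_diag (D : CD F A) (α i j) : D.l ⟨α, i, j⟩ ⟨α, i, j⟩ = D.c α i i := by
  rw [CD.l, D.slR_b, Finset.sum_eq_single i]
  · rw [D.e_c_same]; simp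
  · intro m _ hm
    rw [D.e_c_same]; simp [hm.symm]
  · simp

variable [FiniteDimensional F A]

theorem CD.comul_b (D : CD F A) (s : D.I) :
    Coalgebra.comul (R := F) (D.b s) = ∑ t, D.l s t ⊗ₜ[F] D.b t := by
  refine slR_ext fun f => ?_
  rw [D.slR_l, map_sum]
  exact Finset.sum_congr rfl fun v _ => (slR_tmul _ _ _).symm

theorem CD.l_mm (D : CD F A) : IsMM F D.l := by
  constructor
  · intro s t
    refine slR_ext fun g => ?_
    rw [map_sum]
    simp only [slR_tmul]
    have h1 := rho_mul (WithConv.toConv g) (WithConv.toConv (D.e t)) (D.b s)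
    refine h1.symm.trans ?_
    rw [D.slR_l]
    refine Finset.sum_congr rfl fun v _ => ?_
    congr 1
    exact conv_app (WithConv.toConv g) (WithConv.toConv (D.e t)) (D.b v)
  · intro s t
    rw [CD.l, sl_comm, lam_counit, D.e_b]
    simp only [eq_comm]

theorem CD.b_eq (D : CD F A) (s : D.I) :
    D.b s = ∑ t, Coalgebra.counit (R := F) (D.b t) • D.l s t := by
  rw [← D.slR_l, rho_counit]

theorem CD.comul_Qb (D : CD F A) (s : D.I) :
    Coalgebra.comul (R := F) (Q2 F A (D.b s)) =
      ∑ t, Q2 F A (D.l s t) ⊗ₜ[F] Q2 F A (D.b t) := by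
  have h := D.l_mm.S2.1
  conv_lhs => rw [D.b_eq s]
  simp only [map_sum, map_smul]
  have h2 : ∀ t, Coalgebra.comul (R := F) (Q2 F A (D.l s t)) =
      ∑ u, Q2 F A (D.l s u) ⊗ₜ[F] Q2 F A (D.l u t) := fun t => h s t
  simp only [h2, Finset.smul_sum]
  rw [Finset.sum_comm]
  refine Finset.sum_congr rfl fun u _ => ?_
  conv_rhs => rw [D.b_eq u]
  simp only [map_sum, map_smul, TensorProduct.tmul_sum, TensorProduct.tmul_smul]

theorem trace_lemma {J : Type*} [Fintype J] [DecidableEq J] (G L : Matrix J J A)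
    (φ ψ : J → J → F) (e1 : ∀ i j, ∑ p, φ i p * ψ p j = if i = j then 1 else 0)
    (h : ∀ i j, ∑ p, φ p j • G i p = ∑ p, φ i p • L p j) : G.trace = L.trace := by
  have h1 : Matrix.of φ * Matrix.of ψ = 1 := by
    ext i j
    rw [Matrix.mul_apply, Matrix.one_apply]
    exact e1 i j
  have h2 : Matrix.of ψ * Matrix.of φ = 1 := mul_eq_one_comm.mp h1
  have e2 : ∀ i j, ∑ p, ψ i p * φ p j = if i = j then 1 else 0 := fun i j => by
    have := congrFun (congrFun h2 i) j
    rwa [Matrix.mul_apply, Matrix.one_apply] at this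
  have a1 : ∑ i, ∑ j, ψ j i • ∑ p, φ p j • G i p = G.trace := by
    rw [Matrix.trace]
    refine Finset.sum_congr rfl fun i _ => ?_
    simp only [Finset.smul_sum, smul_smul]
    rw [Finset.sum_comm]
    have : ∀ p, ∑ j, (ψ j i * φ p j) • G i p = if p = i then G i p else 0 := fun p => by
      rw [← Finset.sum_smul]
      simp only [mul_comm (ψ _ i)]
      rw [e1]; split_ifs <;> simp
    simp only [this]; simp
  have a2 : ∑ i, ∑ j, ψ j i • ∑ p, φ i p • L p j = L.trace := by
    rw [Matrix.trace, Finset.sum_comm]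
    refine Finset.sum_congr rfl fun j _ => ?_
    simp only [Finset.smul_sum, smul_smul]
    rw [Finset.sum_comm]
    have : ∀ p, ∑ i, (ψ j i * φ i p) • L p j = if j = p then L p j else 0 := fun p => by
      rw [← Finset.sum_smul, e2]; split_ifs <;> simp
    simp only [this]; simp
  rw [← a1, ← a2]
  simp only [h]

/-- the character of the regular comodule -/
def CD.x (D : CD F A) : A := ∑ s, D.l s s

theorem CD.x_mem (D : CD F A) : D.x ∈ coradical F A :=
  Submodule.sum_mem _ fun s _ => D.l_mem s s

theorem CD.sq_x (D : CD F A)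
    (hm : ∀ a ∈ coradical F A, ∀ b ∈ coradical F A, a * b ∈ coradical F A)
    (hs : ∀ a ∈ coradical F A, HopfAlgebra.antipode F a ∈ coradical F A) :
    D.x * D.x = (Fintype.card D.I : F) • D.x := by
  have key := trace_lemma (F := F) (A := A) (J := D.I × D.I)
    (fun p q => D.l p.1 q.1 * D.l p.2 q.2)
    (fun p q => if p.2 = q.2 then D.l p.1 q.1 else 0)
    (fun p q => D.e q.1 (D.b p.1 * D.l p.2 q.2))
    (fun p q => D.e q.1 (D.b p.1 * HopfAlgebra.antipode F (D.l p.2 q.2)))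
    (by
      rintro ⟨s, t⟩ ⟨p, w⟩
      rw [Fintype.sum_prod_type, Finset.sum_comm]
      simp only
      have h1 : ∀ v, ∑ u, D.e u (D.b s * D.l t v) *
          D.e p (D.b u * HopfAlgebra.antipode F (D.l v w)) =
          D.e p (D.b s * (D.l t v * HopfAlgebra.antipode F (D.l v w))) := fun v => by
        rw [← mul_assoc]
        conv_rhs => rw [D.expand (hm _ (D.b_mem s) _ (D.l_mem t v))]
        simp [Finset.sum_mul, map_sum]
      simp only [h1]
      rw [← map_sum, ← Finset.mul_sum, D.l_mm.mul_S]
      by_cases htw : t = w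
      · simp [htw, D.e_b, eq_comm]
      · simp [htw])
    (by
      rintro ⟨s, t⟩ ⟨p, w⟩
      simp only [Fintype.sum_prod_type]
      have h1 : slR (D.e p) (Coalgebra.comul (R := F) (D.b s * D.l t w)) =
          ∑ u, ∑ v, D.e p (D.b u * D.l v w) • (D.l s u * D.l t v) := by
        rw [Bialgebra.comul_mul, D.comul_b, D.l_mm.1, Finset.sum_mul, map_sum]
        refine Finset.sum_congr rfl fun u _ => ?_
        rw [Finset.mul_sum, map_sum]
        refine Finset.sum_congr rfl fun v _ => ?_
        rw [Algebra.TensorProduct.tmul_mul_tmul, slR_tmul]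
      have h2 : slR (D.e p) (Coalgebra.comul (R := F) (D.b s * D.l t w)) =
          ∑ u, D.e u (D.b s * D.l t w) • D.l u p := by
        conv_lhs => rw [D.expand (hm _ (D.b_mem s) _ (D.l_mem t w))]
        simp only [map_sum, map_smul]
        rfl
      rw [← h1, h2]
      refine Finset.sum_congr rfl fun u _ => ?_
      simp)
  have t1 : Matrix.trace (fun p q => D.l p.1 q.1 * D.l p.2 q.2 : Matrix (D.I × D.I) (D.I × D.I) A)
      = D.x * D.x := by
    simp only [Matrix.trace, Matrix.diag, Fintype.sum_prod_type, CD.x, Finset.sum_mul_sum]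
  have t2 : Matrix.trace (fun p q => if p.2 = q.2 then D.l p.1 q.1 else 0 :
      Matrix (D.I × D.I) (D.I × D.I) A) = (Fintype.card D.I : F) • D.x := by
    simp only [Matrix.trace, Matrix.diag, Fintype.sum_prod_type, CD.x, if_true, Finset.sum_const,
      Finset.smul_sum, Finset.card_univ, Nat.cast_smul_eq_nsmul]
  rw [← t1, ← t2, key]

theorem Q2_mem (hs : ∀ a ∈ coradical F A, HopfAlgebra.antipode F a ∈ coradical F A) {a : A}
    (ha : a ∈ coradical F A) : Q2 F A a ∈ coradical F A := hs _ (hs _ ha)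

theorem CD.Q_x (D : CD F A) 
    (hs : ∀ a ∈ coradical F A, HopfAlgebra.antipode F a ∈ coradical F A)
    {N : ℕ} (hN : 0 < N) (hQN : ∀ a ∈ coradical F A, (Q2 F A ^ N) a = a) :
    Q2 F A D.x = D.x := by
  have key := trace_lemma (F := F) (A := A) (J := D.I)
    (fun s t => Q2 F A (D.l s t)) D.l
    (fun s t => D.e t (Q2 F A (D.b s))) (fun s t => D.e t ((Q2 F A ^ (N - 1)) (D.b s)))
    (by
      intro s t
      have : ∑ u, D.e u (Q2 F A (D.b s)) * D.e t ((Q2 F A ^ (N - 1)) (D.b u)) =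
          D.e t ((Q2 F A ^ (N - 1)) (Q2 F A (D.b s))) := by
        conv_rhs => rw [D.expand (Q2_mem hs (D.b_mem s))]
        simp [map_sum]
      rw [this, ← Module.End.mul_apply, ← pow_succ, Nat.sub_add_cancel hN, hQN _ (D.b_mem s), D.e_b]
      simp only [eq_comm])
    (by
      intro s p
      have h1 : slR (D.e p) (Coalgebra.comul (R := F) (Q2 F A (D.b s))) =
          ∑ u, D.e p (Q2 F A (D.b u)) • Q2 F A (D.l s u) := by
        rw [D.comul_Qb, map_sum]
        exact Finset.sum_congr rfl fun u _ => slR_tmul _ _ _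
      have h2 : slR (D.e p) (Coalgebra.comul (R := F) (Q2 F A (D.b s))) =
          ∑ u, D.e u (Q2 F A (D.b s)) • D.l u p := by
        conv_lhs => rw [D.expand (Q2_mem hs (D.b_mem s))]
        simp only [map_sum, map_smul]
        rfl
      rw [← h1, h2])
  rw [CD.x, map_sum]
  exact key

/-- `f(h) = Tr(L_h Q)` -/
def CD.f (D : CD F A) : A →ₗ[F] F :=
  ∑ s, D.e s ∘ₗ LinearMap.mulRight F (Q2 F A (D.b s))

theorem CD.f_apply (D : CD F A) (h : A) : D.f h = ∑ s, D.e s (h * Q2 F A (D.b s)) := by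
  simp [CD.f]

theorem CD.f_slice (D : CD F A)
    (hm : ∀ a ∈ coradical F A, ∀ b ∈ coradical F A, a * b ∈ coradical F A)
    (hs : ∀ a ∈ coradical F A, HopfAlgebra.antipode F a ∈ coradical F A) (α i j) :
    ∑ m, D.f (D.c α m j) • D.c α i m = D.f (D.c α i j) • (1 : A) := by
  have h0 : ∀ s w, ∑ m, ∑ u, D.e w (D.c α m j * Q2 F A (D.b u)) • (D.c α i m * Q2 F A (D.l s u)) =
      ∑ t, D.e t (D.c α i j * Q2 F A (D.b s)) • D.l t w := by
    intro s w
    have h1 : slR (D.e w) (Coalgebra.comul (R := F) (D.c α i j * Q2 F A (D.b s))) =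
        ∑ m, ∑ u, D.e w (D.c α m j * Q2 F A (D.b u)) • (D.c α i m * Q2 F A (D.l s u)) := by
      rw [Bialgebra.comul_mul, D.comul_Qb, (D.mm α).1, Finset.sum_mul, map_sum]
      refine Finset.sum_congr rfl fun u _ => ?_
      rw [Finset.mul_sum, map_sum]
      refine Finset.sum_congr rfl fun v _ => ?_
      rw [Algebra.TensorProduct.tmul_mul_tmul, slR_tmul]
    have h2 : slR (D.e w) (Coalgebra.comul (R := F) (D.c α i j * Q2 F A (D.b s))) =
        ∑ t, D.e t (D.c α i j * Q2 F A (D.b s)) • D.l t w := by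
      conv_lhs => rw [D.expand (hm _ (D.c_mem α i j) _ (Q2_mem hs (D.b_mem s)))]
      simp only [map_sum, map_smul]
      rfl
    rw [← h1, h2]
  have h1 : ∑ s, ∑ w, (∑ t, D.e t (D.c α i j * Q2 F A (D.b s)) • D.l t w) *
      HopfAlgebra.antipode F (D.l w s) = D.f (D.c α i j) • (1 : A) := by
    rw [D.f_apply, Finset.sum_smul]
    refine Finset.sum_congr rfl fun s _ => ?_
    simp only [Finset.sum_mul, smul_mul_assoc]
    rw [Finset.sum_comm]
    simp only [← Finset.smul_sum, D.l_mm.mul_S]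
    simp
  have h2 : ∑ s, ∑ w, (∑ m, ∑ u, D.e w (D.c α m j * Q2 F A (D.b u)) •
      (D.c α i m * Q2 F A (D.l s u))) * HopfAlgebra.antipode F (D.l w s) =
      ∑ m, D.f (D.c α m j) • D.c α i m := by
    have h3 : ∀ w u, ∑ s, Q2 F A (D.l s u) * HopfAlgebra.antipode F (D.l w s) =
      if w = u then 1 else 0 := fun w u => D.l_mm.S2_mul w u
    simp only [Finset.sum_mul, smul_mul_assoc, mul_assoc]
    calc _ = ∑ w, ∑ m, ∑ u, ∑ s, D.e w (D.c α m j * Q2 F A (D.b u)) •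
          (D.c α i m * (Q2 F A (D.l s u) * HopfAlgebra.antipode F (D.l w s))) := by
          rw [Finset.sum_comm]
          refine Finset.sum_congr rfl fun w _ => ?_
          rw [Finset.sum_comm]
          refine Finset.sum_congr rfl fun m _ => ?_
          rw [Finset.sum_comm]
      _ = ∑ w, ∑ m, D.e w (D.c α m j * Q2 F A (D.b w)) • D.c α i m := by
          refine Finset.sum_congr rfl fun w _ => ?_
          refine Finset.sum_congr rfl fun m _ => ?_
          simp only [← Finset.smul_sum, ← Finset.mul_sum, h3]
          simp
      _ = _ := by
          rw [Finset.sum_comm]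
          refine Finset.sum_congr rfl fun m _ => ?_
          rw [D.f_apply, Finset.sum_smul]
  rw [← h1, ← h2]
  refine Finset.sum_congr rfl fun s _ => ?_
  refine Finset.sum_congr rfl fun w _ => ?_
  rw [h0]

theorem CD.f_x (D : CD F A) (h1 : (1 : A) ∈ coradical F A)
    (hm : ∀ a ∈ coradical F A, ∀ b ∈ coradical F A, a * b ∈ coradical F A)
    (hs : ∀ a ∈ coradical F A, HopfAlgebra.antipode F a ∈ coradical F A) :
    D.f D.x = D.f 1 := by
  have h2 : ∀ α i j, D.f (D.c α j j) = D.f (D.c α i j) * D.e ⟨α, i, j⟩ 1 := by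
    intro α i j
    have h := congrArg (D.e ⟨α, i, j⟩) (D.f_slice hm hs α i j)
    rw [map_sum, Finset.sum_eq_single j] at h
    · rw [map_smul, map_smul, D.e_c_same] at h
      simpa using h
    · intro m _ hmj
      rw [map_smul, D.e_c_same]; simp [hmj.symm]
    · simp
  conv_rhs => rw [D.expand h1]
  rw [CD.x, map_sum, map_sum, D.sum_I, D.sum_I]
  refine Finset.sum_congr rfl fun α _ => ?_
  rw [Finset.sum_comm]
  refine Finset.sum_congr rfl fun i _ => ?_
  refine Finset.sum_congr rfl fun j _ => ?_
  rw [D.l_diag, map_smul, smul_eq_mul]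
  rw [mul_comm]
  exact h2 α i j
end partB

section blocks
variable {F : Type*} [Field F]

theorem skolem {n : Type*} [Fintype n] [DecidableEq n] (g : Matrix n n F →ₐ[F] Matrix n n F)
    (hg : Function.Bijective g) : ∃ P P' : Matrix n n F, P * P' = 1 ∧ ∀ X, g X = P * X * P' := by
  let f := ((Matrix.toLinAlgEquiv' (R := F) (n := n)).symm.trans
    (AlgEquiv.ofBijective g hg)).trans Matrix.toLinAlgEquiv'
  obtain ⟨T, hT⟩ := f.eq_linearEquivConjAlgEquiv
  refine ⟨LinearMap.toMatrix' T.toLinearMap, LinearMap.toMatrix' T.symm.toLinearMap, ?_, ?_⟩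
  · rw [← LinearMap.toMatrix'_comp]; simp
  · intro X
    have h1 : f (Matrix.toLinAlgEquiv' X) = Matrix.toLinAlgEquiv' (g X) := by simp [f]
    have h2 : f (Matrix.toLin' X) = Matrix.toLin' (g X) := h1
    rw [hT, LinearEquiv.conjAlgEquiv_apply] at h2
    have h3 := congrArg LinearMap.toMatrix' h2
    rw [LinearMap.toMatrix'_comp, LinearMap.toMatrix'_comp, LinearMap.toMatrix'_toLin',
      LinearMap.toMatrix'_toLin'] at h3
    rw [← h3, mul_assoc]

theorem commute_scalar {n : Type*} [Fintype n] [DecidableEq n] (P : Matrix n n F)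
    (h : ∀ X, P * X = X * P) : ∃ t : F, P = t • (1 : Matrix n n F) := by
  obtain ⟨t, ht⟩ := Matrix.mem_range_scalar_iff_commute_single'.mpr
    (fun i j => (h (Matrix.single i j 1)).symm)
  exact ⟨t, by rw [← ht]; ext i j; simp [Matrix.one_apply, Matrix.diagonal_apply]⟩

variable [IsAlgClosed F] [CharZero F]

theorem block_pos {N : ℕ} (hN : 0 < N) {K : Type*} [Field K] {ι : K →+* F} {φ : K →+* ℂ} {z : K}
    (hz : IsPrimitiveRoot z N) (hιz : IsPrimitiveRoot (ι z) N)
    {n : Type*} [Fintype n] [DecidableEq n] (g : Matrix n n F →ₐ[F] Matrix n n F)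
    (hg : ∀ X, g^[N] X = X) : PosEl ι φ (∑ i, ∑ j, g (Matrix.single i j 1) i j) := by
  by_cases hn : IsEmpty n
  · simp only [Finset.univ_eq_empty, Finset.sum_empty]
    exact ⟨0, by simp, 0, le_rfl, by simp⟩
  rw [not_isEmpty_iff] at hn
  have hinj : Function.Injective g := by
    intro X Y hXY
    rw [← hg X, ← hg Y, ← Nat.sub_add_cancel hN, Function.iterate_succ_apply,
      Function.iterate_succ_apply, hXY]
  have hsurj : Function.Surjective g := by
    intro X
    refine ⟨g^[N - 1] X, ?_⟩
    rw [← Function.iterate_succ_apply' g, Nat.succ_eq_add_one, Nat.sub_add_cancel hN, hg]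
  obtain ⟨P, P', hP, hgP⟩ := skolem g ⟨hinj, hsurj⟩
  have hP' : P' * P = 1 := mul_eq_one_comm.mp hP
  have hit : ∀ m X, g^[m] X = P ^ m * X * P' ^ m := by
    intro m
    induction m with
    | zero => intro X; simp
    | succ m ih =>
      intro X
      rw [Function.iterate_succ_apply', ih, hgP, pow_succ' P, pow_succ P']
      simp only [mul_assoc]
  have hPP : ∀ m : ℕ, P' ^ m * P ^ m = 1 := fun m => by
    have hc : Commute P' P := by rw [Commute, SemiconjBy, hP, hP']
    rw [← hc.mul_pow, hP', one_pow]
  obtain ⟨s, hs⟩ := commute_scalar (P ^ N) fun X => by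
    have h1 : P ^ N * X * P' ^ N = X := by rw [← hit, hg]
    conv_rhs => rw [← h1]
    rw [mul_assoc (P ^ N * X), hPP, mul_one]
  have hs0 : s ≠ 0 := by
    intro h0
    have := hPP N
    rw [hs, h0, zero_smul, mul_zero] at this
    exact zero_ne_one this
  obtain ⟨r, hr⟩ := IsAlgClosed.exists_pow_nat_eq s hN
  have hr0 : r ≠ 0 := by intro h; rw [h, zero_pow hN.ne'] at hr; exact hs0 hr.symm
  set B := r⁻¹ • P with hB
  have hBN : B ^ N = 1 := by
    rw [hB, smul_pow, hs, smul_smul, inv_pow, hr, inv_mul_cancel₀ hs0, one_smul]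
  have hBB : B ^ (N - 1) = r • P' := by
    have h1 : B * (r • P') = 1 := by
      rw [hB, smul_mul_smul_comm, hP, inv_mul_cancel₀ hr0, one_smul]
    have h2 : B ^ (N - 1) * B = 1 := by rw [← pow_succ, Nat.sub_add_cancel hN, hBN]
    calc B ^ (N - 1) = B ^ (N - 1) * (B * (r • P')) := by rw [h1, mul_one]
      _ = r • P' := by rw [← mul_assoc, h2, one_mul]
  have hgB : ∀ X, g X = B * X * B ^ (N - 1) := fun X => by
    rw [hBB, hB, smul_mul_assoc, smul_mul_smul_comm, inv_mul_cancel₀ hr0, one_smul, hgP]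
  have hp := posEl_trace (F := F) (φ := φ) hN hz hιz (Matrix.toLinAlgEquiv' B)
    (by rw [← map_pow, hBN, map_one])
  rw [← map_pow] at hp
  have e1 : ∀ X : Matrix n n F, LinearMap.trace F (n → F) (Matrix.toLinAlgEquiv' X) = X.trace :=
    fun X => Matrix.trace_toLin'_eq X
  rw [e1, e1] at hp
  convert hp using 1
  rw [Matrix.trace, Matrix.trace, Finset.sum_mul_sum]
  refine Finset.sum_congr rfl fun i _ => Finset.sum_congr rfl fun j _ => ?_
  rw [hgB]
  have e2 : ∀ p, (B * Matrix.single i j (1 : F)) i p = if p = j then B i i else 0 := fun p => by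
    rw [Matrix.mul_apply, Finset.sum_eq_single i]
    · by_cases hp : p = j
      · simp [hp]
      · rw [if_neg hp, Matrix.single_apply, if_neg, mul_zero]
        exact fun h => hp h.2.symm
    · intro q _ hq
      rw [Matrix.single_apply, if_neg, mul_zero]
      exact fun h => hq h.1.symm
    · simp
  rw [Matrix.mul_apply]
  simp only [e2]
  simp

theorem pi_block_pos {N : ℕ} (hN : 0 < N) {K : Type*} [Field K] {ι : K →+* F} {φ : K →+* ℂ} {z : K}
    (hz : IsPrimitiveRoot z N) (hιz : IsPrimitiveRoot (ι z) N)
    {m : ℕ} {d : Fin m → ℕ}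
    (Θ : ((α : Fin m) → Matrix (Fin (d α)) (Fin (d α)) F) →ₐ[F]
      ((α : Fin m) → Matrix (Fin (d α)) (Fin (d α)) F))
    (hΘ : ∀ X, Θ^[N] X = X) (α : Fin m) :
    PosEl ι φ (∑ i, ∑ j, Θ (Pi.single α (Matrix.single i j 1)) α i j) := by
  set e : (α : Fin m) → Matrix (Fin (d α)) (Fin (d α)) F := Pi.single α 1 with he
  have hes : ∀ X, e * X = Pi.single α (X α) := by
    intro X
    ext1 β
    by_cases hβ : β = α
    · subst hβ; simp [he]
    · simp [he, hβ]
  have hse : ∀ X, X * e = Pi.single α (X α) := by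
    intro X
    ext1 β
    by_cases hβ : β = α
    · subst hβ; simp [he]
    · simp [he, hβ]
  have hee : e * e = e := by rw [hes, he, Pi.single_eq_same]
  have hsurj : Function.Surjective Θ := by
    intro X
    refine ⟨Θ^[N - 1] X, ?_⟩
    rw [← Function.iterate_succ_apply' Θ, Nat.succ_eq_add_one, Nat.sub_add_cancel hN, hΘ]
  have hcent : ∀ Y, Θ e * Y = Y * Θ e := by
    intro Y
    obtain ⟨X, rfl⟩ := hsurj Y
    rw [← map_mul, ← map_mul, hes, hse]
  obtain ⟨t, ht⟩ := commute_scalar (Θ e α) fun X => by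
    have := congrFun (hcent (Pi.single α X)) α
    simpa using this
  have hidem : Θ e α * Θ e α = Θ e α := by
    have := congrFun (congrArg Θ hee) α
    rwa [map_mul] at this
  have hsing : ∀ X : Matrix (Fin (d α)) (Fin (d α)) F, 
      (Pi.single α X : (α : Fin m) → Matrix (Fin (d α)) (Fin (d α)) F) = Pi.single α X * e := by
    intro X; rw [hse, Pi.single_eq_same]
  have hcase : Θ e α = 0 ∨ Θ e α = 1 := by
    by_cases ht0 : t = 0
    · left; rw [ht, ht0, zero_smul]
    · right
      rw [ht, smul_mul_smul_comm, mul_one, mul_smul] at hidem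
      have h5 := congrArg (fun M => t⁻¹ • M) hidem
      simp only [smul_smul, inv_mul_cancel₀ ht0, one_smul] at h5
      rw [← mul_assoc, inv_mul_cancel₀ ht0, one_mul] at h5
      rw [ht, h5]
  rcases hcase with h0 | h1
  · have : ∀ i j, Θ (Pi.single α (Matrix.single i j 1)) α i j = 0 := by
      intro i j
      rw [hsing, map_mul, Pi.mul_apply, h0, mul_zero]; rfl
    simp only [this, Finset.sum_const_zero]
    exact ⟨0, by simp, 0, le_rfl, by simp⟩
  · have hb1 : e * Θ e = e := by rw [hes, h1]
    have hk : ∀ k, e * Θ^[k] e = e := by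
      intro k
      induction k with
      | zero => simpa using hee
      | succ k ih =>
        have h2 := congrArg Θ ih
        rw [map_mul, ← Function.iterate_succ_apply' Θ] at h2
        calc e * Θ^[k + 1] e = e * Θ e * Θ^[k + 1] e := by rw [hb1]
          _ = e := by rw [mul_assoc, h2, hb1]
    have hΘe : Θ e = e := by
      have h2 := congrArg Θ (hk (N - 1))
      rw [map_mul, ← Function.iterate_succ_apply' Θ, Nat.succ_eq_add_one, Nat.sub_add_cancel hN,
        hΘ, hcent, hb1] at h2
      exact h2.symm
    have hblk : ∀ X : Matrix (Fin (d α)) (Fin (d α)) F,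
        Θ (Pi.single α X) = Pi.single α (Θ (Pi.single α X) α) := by
      intro X
      rw [← hse, ← hΘe, ← map_mul, ← hsing]
    let g : Matrix (Fin (d α)) (Fin (d α)) F →ₐ[F] Matrix (Fin (d α)) (Fin (d α)) F :=
      AlgHom.ofLinearMap
        (LinearMap.proj α ∘ₗ Θ.toLinearMap ∘ₗ
          LinearMap.single F (fun α => Matrix (Fin (d α)) (Fin (d α)) F) α)
        (by simpa [he] using h1)
        (by
          intro X Y
          simp only [LinearMap.comp_apply, LinearMap.single_apply, AlgHom.toLinearMap_apply,
            LinearMap.proj_apply]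
          rw [Pi.single_mul, map_mul, Pi.mul_apply])
    have hgX : ∀ X, g X = Θ (Pi.single α X) α := fun X => rfl
    have hgN : ∀ k X, (Pi.single α (g^[k] X) : (α : Fin m) → Matrix (Fin (d α)) (Fin (d α)) F) =
        Θ^[k] (Pi.single α X) := by
      intro k X
      induction k with
      | zero => rfl
      | succ k ih =>
        rw [Function.iterate_succ_apply', Function.iterate_succ_apply', ← ih, hgX, ← hblk]
    refine block_pos hN hz hιz g fun X => ?_
    have := congrFun (hgN N X) α
    rw [hΘ] at this
    simpa using this
end blocks

section partB2
variable {F A : Type*} [Field F] [Ring A] [HopfAlgebra F A]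

theorem CD.ext_fun (D : CD F A) (f g : A →ₗ[F] F) (h : ∀ s, f (D.b s) = g (D.b s)) {a : A}
    (ha : a ∈ coradical F A) : f a = g a := by
  rw [D.expand ha]; simp only [map_sum, map_smul, h]

/-- block matrices -/
abbrev CD.R (D : CD F A) : Type _ := (α : Fin D.m) → Matrix (Fin (D.d α)) (Fin (D.d α)) F

/-- the functional attached to a block matrix -/
def CD.FX (D : CD F A) : D.R →ₗ[F] (A →ₗ[F] F) where
  toFun X := ∑ s : D.I, X s.1 s.2.1 s.2.2 • D.e s
  map_add' X Y := by simp [add_smul, Finset.sum_add_distrib]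
  map_smul' t X := by simp [Finset.smul_sum, smul_smul]

theorem CD.FX_b (D : CD F A) (X : D.R) (s : D.I) : D.FX X (D.b s) = X s.1 s.2.1 s.2.2 := by
  simp only [CD.FX, LinearMap.coe_mk, AddHom.coe_mk, LinearMap.sum_apply, LinearMap.smul_apply,
    D.e_b]
  simp

theorem CD.FX_c (D : CD F A) (X : D.R) (α i j) : D.FX X (D.c α i j) = X α i j :=
  D.FX_b X ⟨α, i, j⟩

theorem CD.FX_mul (D : CD F A) (X Y : D.R) {a : A} (ha : a ∈ coradical F A) :
    D.FX (X * Y) a = D.FX X (slR (D.FX Y) (Coalgebra.comul (R := F) a)) := by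
  refine D.ext_fun (D.FX (X * Y)) (D.FX X ∘ₗ slR (D.FX Y) ∘ₗ Coalgebra.comul) ?_ ha
  rintro ⟨α, i, j⟩
  rw [D.FX_b, LinearMap.comp_apply, LinearMap.comp_apply, D.slR_b, map_sum]
  simp only [map_smul, D.FX_c, Pi.mul_apply, Matrix.mul_apply, smul_eq_mul]
  exact Finset.sum_congr rfl fun m _ => mul_comm _ _

variable [FiniteDimensional F A]

/-- the dual of `S²` on the block matrices -/
def CD.Th (D : CD F A)
    (hs : ∀ a ∈ coradical F A, HopfAlgebra.antipode F a ∈ coradical F A) : D.R →ₐ[F] D.R :=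
  AlgHom.ofLinearMap
    { toFun := fun X α i j => D.FX X (Q2 F A (D.c α i j))
      map_add' := fun X Y => by
        ext α i j
        change D.FX (X + Y) _ = D.FX X _ + D.FX Y _
        simp
      map_smul' := fun t X => by
        ext α i j
        change D.FX (t • X) _ = t • D.FX X _
        simp }
    (by
      ext α i j
      change D.FX 1 (Q2 F A (D.c α i j)) = (1 : Matrix (Fin (D.d α)) (Fin (D.d α)) F) i j
      rw [D.ext_fun (D.FX 1) (Coalgebra.counit (R := F)) ?_ (Q2_mem hs (D.c_mem α i j))]
      · rw [Matrix.one_apply]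
        exact (D.mm α).S2.2 i j
      · rintro ⟨β, a, b⟩
        rw [D.FX_b]
        exact (Matrix.one_apply).trans ((D.mm β).2 a b).symm)
    (by
      intro X Y
      ext α i j
      change D.FX (X * Y) (Q2 F A (D.c α i j)) =
        ((Matrix.of fun i j => D.FX X (Q2 F A (D.c α i j))) *
          (Matrix.of fun i j => D.FX Y (Q2 F A (D.c α i j)))) i j
      rw [D.FX_mul X Y (Q2_mem hs (D.c_mem α i j))]
      have h := (D.mm α).S2.slR (D.FX Y) i j
      refine (congrArg (D.FX X) h).trans ?_
      rw [map_sum]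
      simp only [map_smul, smul_eq_mul]
      refine (Finset.sum_congr rfl fun m _ => mul_comm _ _).trans ?_
      rfl)

theorem CD.Th_apply (D : CD F A)
    (hs : ∀ a ∈ coradical F A, HopfAlgebra.antipode F a ∈ coradical F A) (X : D.R) (α i j) :
    D.Th hs X α i j = D.FX X (Q2 F A (D.c α i j)) := rfl

theorem CD.Th_iter (D : CD F A)
    (hs : ∀ a ∈ coradical F A, HopfAlgebra.antipode F a ∈ coradical F A) (X : D.R) (n : ℕ) :
    ∀ α i j, (D.Th hs)^[n] X α i j = D.FX X ((Q2 F A ^ n) (D.c α i j)) := by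
  induction n with
  | zero => intro α i j; simp [D.FX_c]
  | succ n ih =>
    intro α i j
    rw [Function.iterate_succ_apply', D.Th_apply, pow_succ, Module.End.mul_apply]
    refine D.ext_fun (D.FX ((D.Th hs)^[n] X)) (D.FX X ∘ₗ (Q2 F A ^ n)) ?_
      (Q2_mem hs (D.c_mem α i j))
    rintro ⟨β, a, b⟩
    rw [D.FX_b]
    exact ih β a b

theorem CD.Q_one : Q2 F A (1 : A) = 1 := by
  rw [Q2_apply, HopfAlgebra.antipode_one, HopfAlgebra.antipode_one]

theorem CD.one_block (D : CD F A) (h1 : (1 : A) ∈ coradical F A) :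
    ∃ α p, D.c α p p = 1 ∧ ∀ i, i = p := by
  have hne : (1 : A) ≠ 0 := by
    intro h
    have h2 : Coalgebra.counit (R := F) (1 : A) = 1 := Bialgebra.counit_one
    rw [h, map_zero] at h2
    exact zero_ne_one h2
  have hR : ∀ α p q, D.e ⟨α, p, q⟩ 1 • (1 : A) = ∑ i, D.e ⟨α, i, q⟩ 1 • D.c α i p := by
    intro α p q
    have e1 : slR (D.e ⟨α, p, q⟩) (Coalgebra.comul (R := F) (1 : A)) =
        D.e ⟨α, p, q⟩ 1 • (1 : A) := by
      rw [Bialgebra.comul_one, Algebra.TensorProduct.one_def, slR_tmul]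
    rw [← e1]
    conv_lhs => rw [D.expand h1]
    simp only [map_sum, map_smul]
    rw [D.sum_I, Finset.sum_eq_single α]
    · refine Finset.sum_congr rfl fun i _ => ?_
      rw [Finset.sum_eq_single q]
      · rw [D.slR_b, Finset.sum_eq_single p]
        · rw [D.e_c_same]; simp
        · intro m _ hm
          rw [D.e_c_same]; simp [hm.symm]
        · simp
      · intro j _ hj
        rw [D.slR_b]
        simp [D.e_c_same, hj.symm]
      · simp
    · intro β _ hβ
      refine Finset.sum_eq_zero fun i _ => Finset.sum_eq_zero fun j _ => ?_
      rw [D.slR_b]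
      simp [D.e_c_ne hβ.symm]
    · simp
  have hL : ∀ α p q, D.e ⟨α, p, q⟩ 1 • (1 : A) = ∑ j, D.e ⟨α, p, j⟩ 1 • D.c α q j := by
    intro α p q
    have e1 : slL (D.e ⟨α, p, q⟩) (Coalgebra.comul (R := F) (1 : A)) =
        D.e ⟨α, p, q⟩ 1 • (1 : A) := by
      rw [Bialgebra.comul_one, Algebra.TensorProduct.one_def, slL_tmul]
    have hb : ∀ (β : Fin D.m) (i j : Fin (D.d β)),
        slL (D.e ⟨α, p, q⟩) (Coalgebra.comul (R := F) (D.b ⟨β, i, j⟩)) =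
        ∑ m, D.e ⟨α, p, q⟩ (D.c β i m) • D.c β m j := fun β i j => (D.mm β).slL _ i j
    rw [← e1]
    conv_lhs => rw [D.expand h1]
    simp only [map_sum, map_smul]
    rw [D.sum_I, Finset.sum_eq_single α]
    · rw [Finset.sum_comm]
      refine Finset.sum_congr rfl fun j _ => ?_
      rw [Finset.sum_eq_single p]
      · rw [hb, Finset.sum_eq_single q]
        · rw [D.e_c_same]; simp
        · intro m _ hm
          rw [D.e_c_same]; simp [hm.symm]
        · simp
      · intro i _ hi
        rw [hb]
        simp [D.e_c_same, hi.symm]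
      · simp
    · intro β _ hβ
      refine Finset.sum_eq_zero fun i _ => Finset.sum_eq_zero fun j _ => ?_
      rw [hb]
      simp [D.e_c_ne hβ.symm]
    · simp
  obtain ⟨⟨α, p, q⟩, hpq⟩ : ∃ s, D.e s 1 ≠ 0 := by
    by_contra hcon
    push Not at hcon
    apply hne
    rw [D.expand h1]
    simp [hcon]
  have h2 : ∀ i m, D.e ⟨α, p, q⟩ 1 * D.e ⟨α, i, m⟩ 1 = if m = p then D.e ⟨α, i, q⟩ 1 else 0 := by
    intro i m
    have h := congrArg (D.e ⟨α, i, m⟩) (hR α p q)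
    rw [map_smul, smul_eq_mul, map_sum] at h
    rw [h, Finset.sum_eq_single i]
    · rw [map_smul, D.e_c_same]; split_ifs <;> simp_all
    · intro j _ hj
      rw [map_smul, D.e_c_same]; simp [hj.symm]
    · simp
  have h3 : ∀ i m, D.e ⟨α, p, q⟩ 1 * D.e ⟨α, i, m⟩ 1 = if i = q then D.e ⟨α, p, m⟩ 1 else 0 := by
    intro i m
    have h := congrArg (D.e ⟨α, i, m⟩) (hL α p q)
    rw [map_smul, smul_eq_mul, map_sum] at h
    rw [h, Finset.sum_eq_single m]
    · rw [map_smul, D.e_c_same]; split_ifs <;> simp_all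
    · intro j _ hj
      rw [map_smul, D.e_c_same]; simp [hj.symm]
    · simp
  have hqp : q = p := by
    by_contra hcon
    have := h2 p q
    rw [if_neg hcon] at this
    exact hpq (mul_self_eq_zero.mp this)
  subst hqp
  have hη : D.e ⟨α, q, q⟩ 1 = 1 := by
    have := h2 q q
    rw [if_pos rfl] at this
    exact mul_left_cancel₀ hpq (by rw [this, mul_one])
  have hone : D.c α q q = 1 := by
    have h := hR α q q
    rw [hη, one_smul, Finset.sum_eq_single q] at h
    · rw [hη, one_smul] at h; exact h.symm
    · intro i _ hi
      have := h3 i q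
      rw [if_neg hi, hη, one_mul] at this
      rw [this, zero_smul]
    · simp
  refine ⟨α, q, hone, fun i => ?_⟩
  by_contra hi
  have h4 := D.slR_b (D.e ⟨α, i, q⟩) α q q
  rw [Finset.sum_eq_single i] at h4
  · rw [show D.b ⟨α, q, q⟩ = (1 : A) from hone, Bialgebra.comul_one,
      Algebra.TensorProduct.one_def, slR_tmul, D.e_c_same] at h4
    rw [← hone, D.e_c_same] at h4
    have h5 := congrArg (D.e ⟨α, q, i⟩) h4
    rw [map_smul, map_smul, D.e_c_same, D.e_c_same] at h5
    simp [hi] at h5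
  · intro m _ hm
    rw [D.e_c_same]; simp [hm.symm]
  · simp

variable [IsAlgClosed F] [CharZero F]

theorem CD.f_one_ne (D : CD F A) (h1 : (1 : A) ∈ coradical F A)
    (hs : ∀ a ∈ coradical F A, HopfAlgebra.antipode F a ∈ coradical F A)
    {N : ℕ} (hN : 0 < N) (hQN : ∀ a ∈ coradical F A, (Q2 F A ^ N) a = a) : D.f 1 ≠ 0 := by
  obtain ⟨K, _, _, ι, z, φ, hz, hιz⟩ := cyc_data F hN
  have hΘ : ∀ X, (D.Th hs)^[N] X = X := by
    intro X
    ext α i j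
    rw [D.Th_iter, hQN _ (D.c_mem α i j), D.FX_c]
  have hpos := fun α => pi_block_pos hN (φ := φ) hz hιz (D.Th hs) hΘ α
  have hterm : ∀ α i j, D.Th hs (Pi.single α (Matrix.single i j 1)) α i j =
      D.e ⟨α, i, j⟩ (Q2 F A (D.c α i j)) := by
    intro α i j
    rw [D.Th_apply]
    refine D.ext_fun _ _ ?_ (Q2_mem hs (D.c_mem α i j))
    rintro ⟨β, a, b⟩
    rw [D.FX_b]
    change _ = D.e ⟨α, i, j⟩ (D.c β a b)
    by_cases hβ : α = β
    · subst hβ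
      rw [D.e_c_same]
      simp [Matrix.single_apply]
    · rw [D.e_c_ne hβ]
      simp [Pi.single_eq_of_ne (Ne.symm hβ)]
  obtain ⟨α, p, hp, hu⟩ := D.one_block h1
  have hsum : D.f 1 = 1 + ∑ β ∈ Finset.univ.erase α,
      ∑ i, ∑ j, D.Th hs (Pi.single β (Matrix.single i j 1)) β i j := by
    rw [D.f_apply, D.sum_I, ← Finset.add_sum_erase _ _ (Finset.mem_univ α)]
    simp only [one_mul, hterm]
    congr 1
    rw [Finset.sum_eq_single p, Finset.sum_eq_single p]
    · change D.e ⟨α, p, p⟩ (Q2 F A (D.c α p p)) = 1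
      rw [hp, CD.Q_one, ← hp, D.e_c_same]; simp
    · intro i _ hi; exact absurd (hu i) hi
    · simp
    · intro i _ hi; exact absurd (hu i) hi
    · simp
  rw [hsum]
  exact (PosEl.sum _ _ fun β _ => hpos β).one_add_ne

/-- the basis of the coradical -/
theorem CD.exists_basis (D : CD F A) :
    ∃ B : Module.Basis D.I F (coradical F A), (∀ s, (B s : A) = D.b s) ∧
      ∀ a s, B.repr a s = D.e s a := by
  let v : D.I → coradical F A := fun s => ⟨D.b s, D.b_mem s⟩
  have hli : LinearIndependent F v := by
    apply LinearIndependent.of_comp (coradical F A).subtype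
    exact D.li
  have hsp : ⊤ ≤ Submodule.span F (Set.range v) := by
    rintro ⟨a, ha⟩ -
    rw [Submodule.mem_span_range_iff_exists_fun]
    refine ⟨fun s => D.e s a, Subtype.ext ?_⟩
    refine Eq.trans ?_ (D.expand ha).symm
    simp [v]
  refine ⟨Module.Basis.mk hli hsp, fun s => by rw [Module.Basis.mk_apply], fun a s => ?_⟩
  have hB : ∀ t, ((Module.Basis.mk hli hsp t : coradical F A) : A) = D.b t := fun t => by
    rw [Module.Basis.mk_apply]
  have h := congrArg (fun w : coradical F A => D.e s (w : A))
    ((Module.Basis.mk hli hsp).sum_repr a)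
  simp only [Submodule.coe_sum, Submodule.coe_smul, hB, map_sum, map_smul, D.e_b] at h
  rw [← h]; simp

theorem CD.trace_restrict (D : CD F A) (g : Module.End F A)
    (hg : ∀ a ∈ coradical F A, g a ∈ coradical F A) :
    LinearMap.trace F (coradical F A) (g.restrict hg) = ∑ s, D.e s (g (D.b s)) := by
  obtain ⟨B, hB, hr⟩ := D.exists_basis
  rw [LinearMap.trace_eq_matrix_trace F B]
  simp only [Matrix.trace, Matrix.diag, LinearMap.toMatrix_apply, hr, LinearMap.restrict_coe_apply,
    hB]

theorem partB (D : CD F A) (h1 : (1 : A) ∈ coradical F A)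
    (hm : ∀ a ∈ coradical F A, ∀ b ∈ coradical F A, a * b ∈ coradical F A)
    (hs : ∀ a ∈ coradical F A, HopfAlgebra.antipode F a ∈ coradical F A)
    {N : ℕ} (hN : 0 < N) (hQN : ∀ a ∈ coradical F A, (Q2 F A ^ N) a = a) :
    ∀ a ∈ coradical F A, Q2 F A a = a := by
  have hQm : ∀ a ∈ coradical F A, Q2 F A a ∈ coradical F A := fun a ha => Q2_mem hs ha
  have hxm : ∀ a ∈ coradical F A, LinearMap.mulLeft F D.x a ∈ coradical F A :=
    fun a ha => hm _ D.x_mem _ ha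
  set Q : Module.End F (coradical F A) := (Q2 F A).restrict hQm with hQ
  set X : Module.End F (coradical F A) := (LinearMap.mulLeft F D.x).restrict hxm with hX
  have hcard : Module.finrank F (coradical F A) = Fintype.card D.I := by
    obtain ⟨B, -, -⟩ := D.exists_basis
    exact Module.finrank_eq_card_basis B
  have htQ : LinearMap.trace F (coradical F A) Q = D.f 1 := by
    rw [hQ, D.trace_restrict, D.f_apply]; simp only [one_mul]
  have hXQ : X * Q = (LinearMap.mulLeft F D.x ∘ₗ Q2 F A).restrict
      (fun a ha => hxm _ (hQm a ha)) := rfl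
  have htXQ : LinearMap.trace F (coradical F A) (X * Q) = D.f 1 := by
    rw [hXQ, D.trace_restrict, ← D.f_x h1 hm hs, D.f_apply]; rfl
  have hf := D.f_one_ne h1 hs hN hQN
  set d : F := (Fintype.card D.I : F) with hd
  have hd0 : d ≠ 0 := by
    intro h
    rw [hd, Nat.cast_eq_zero, Fintype.card_eq_zero_iff] at h
    apply hf
    rw [D.f_apply]
    simp only [Finset.univ_eq_empty, Finset.sum_empty]
  have hQpow : Q ^ N = 1 := by
    ext a
    rw [hQ, Module.End.pow_restrict N hQm]
    rw [LinearMap.restrict_coe_apply, hQN _ a.2]; rfl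
  have hXX : X * X = d • X := by
    ext a
    change D.x * (D.x * (a : A)) = d • (D.x * (a : A))
    rw [← mul_assoc, D.sq_x hm hs, smul_mul_assoc]
  have hcomm : X * Q = Q * X := by
    ext a
    change D.x * Q2 F A a = Q2 F A (D.x * a)
    have : Q2 F A (D.x * a) = Q2 F A D.x * Q2 F A a := by
      simp only [Q2_apply, HopfAlgebra.antipode_mul_antidistrib]
    rw [this, D.Q_x hs hN hQN]
  obtain ⟨μ, hμ⟩ := scalar_of_trace hN Q (d⁻¹ • X) hQpow
    (by rw [smul_mul_smul_comm, hXX, smul_smul, mul_assoc, inv_mul_cancel₀ hd0, mul_one])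
    (by rw [smul_mul_assoc, mul_smul_comm, hcomm])
    (by rw [smul_mul_assoc, map_smul, htXQ, htQ, hcard, smul_eq_mul, ← mul_assoc, ← hd,
      mul_inv_cancel₀ hd0, one_mul])
    (by rw [htQ]; exact hf)
  have hμ' : ∀ a ∈ coradical F A, Q2 F A a = μ • a := fun a ha =>
    congrArg Subtype.val (hμ ⟨a, ha⟩)
  have hμ1 : μ = 1 := by
    have h := congrArg (Coalgebra.counit (R := F)) (hμ' 1 h1)
    rw [CD.Q_one, map_smul, Bialgebra.counit_one] at h
    simpa using h.symm
  intro a ha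
  rw [hμ' a ha, hμ1, one_smul]
end partB2

/-- let `H` be a finite-dimensional non-cosemisimple Hopf algebra with the
dual Chevalley property over an algebraically closed field of characteristic `0`, and let
`N = exp(H₀)` (the exponent of the coradical, computed with `T = S⁻²`; it is finite).
Then there are a basic multiplicative matrix `𝒞` over `H` and a non-trivial
`(𝒞,1)`-primitive matrix `𝒳` with `S²(𝒳) = q𝒳` for some `N`-th root of unity `q`. -/
theorem stmt19 (k H : Type*) [Field k] [IsAlgClosed k] [CharZero k]
    [Ring H] [HopfAlgebra k H] [FiniteDimensional k H]
    (hchev : DualChevalley k H)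
    -- `H` is non-cosemisimple:
    (hncss : coradical k H ≠ ⊤)
    -- the inverse of the antipode:
    (Sinv : Module.End k H)
    (hS1 : Sinv ∘ₗ HopfAlgebra.antipode (R := k) (A := H) = LinearMap.id)
    (hS2 : HopfAlgebra.antipode (R := k) (A := H) ∘ₗ Sinv = LinearMap.id)
    -- `N = exp(H₀)`, the least `n ≥ 1` with `m_n ∘ (id ⊗ S⁻² ⊗ ⋯) ∘ Δ_n = u∘ε` on `H₀`:
    (N : ℕ)
    (hN : N = sInf {n : ℕ | 0 < n ∧ ∀ a ∈ coradical k H,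
      twistPow k H (Sinv ∘ₗ Sinv) n a = algebraMap k H (Coalgebra.counit (R := k) a)})
    (hNfin : ∃ n : ℕ, 0 < n ∧ ∀ a ∈ coradical k H,
      twistPow k H (Sinv ∘ₗ Sinv) n a = algebraMap k H (Coalgebra.counit (R := k) a)) :
    ∃ (r : ℕ) (c : Matrix (Fin r) (Fin r) H) (x : Fin r → H) (q : k),
      -- `𝒞` is a basic multiplicative matrix:
      (∀ i j, Coalgebra.comul (R := k) (c i j) = ∑ l, c i l ⊗ₜ[k] c l j) ∧
      (∀ i j, Coalgebra.counit (R := k) (c i j) = if i = j then (1 : k) else 0) ∧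
      LinearIndependent k (fun q : Fin r × Fin r => c q.1 q.2) ∧
      -- `𝒳` is a non-trivial `(𝒞,1)`-primitive matrix:
      (∀ i, Coalgebra.comul (R := k) (x i) =
        (∑ l, c i l ⊗ₜ[k] x l) + x i ⊗ₜ[k] (1 : H)) ∧
      (∃ i, x i ∉ coradical k H) ∧
      -- `q` is an `N`-th root of unity and `S²(𝒳) = q𝒳`:
      q ^ N = 1 ∧
      (∀ i, HopfAlgebra.antipode (R := k) (HopfAlgebra.antipode (R := k) (x i)) = q • x i) := by
  obtain ⟨h1, hm, hs⟩ := hchev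
  have hmem : sInf {n : ℕ | 0 < n ∧ ∀ a ∈ coradical k H,
      twistPow k H (Sinv ∘ₗ Sinv) n a = algebraMap k H (Coalgebra.counit (R := k) a)} ∈
      {n : ℕ | 0 < n ∧ ∀ a ∈ coradical k H,
      twistPow k H (Sinv ∘ₗ Sinv) n a = algebraMap k H (Coalgebra.counit (R := k) a)} :=
    Nat.sInf_mem hNfin
  rw [← hN] at hmem
  obtain ⟨hN0, htw⟩ := hmem
  obtain ⟨D, hD⟩ := exists_CD (F := k) (A := H)
  obtain ⟨T, hT, hTQ, hQT⟩ := exists_TA (F := k) (A := H) Sinv hS1 hS2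
  have hfix := fun α => twist_fix T (D.mm α) (N := N) (fun i j => by
    rw [hT]; exact htw _ (D.c_mem α i j))
  have hQN : ∀ a ∈ coradical k H, (Q2 k H ^ N) a = a := by
    intro a ha
    have hb : ∀ s, (Q2 k H ^ N) (D.b s) = D.b s := fun s =>
      Q_pow_of_T T hQT ((hfix s.1).2 s.2.1 s.2.2)
    conv_lhs => rw [D.expand ha]
    refine Eq.trans ?_ (D.expand ha).symm
    simp only [map_sum, map_smul, hb]
  have hQ := partB D h1 hm hs hN0 hQN
  obtain ⟨v, hv, hv2⟩ := hD hncss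
  obtain ⟨y, hy, hL⟩ := partC1 D hm hs v hv hv2
  obtain ⟨α, x, hx, hxn⟩ := partC2 D h1 y hy hL
  have hTc : ∀ i j, T (D.c α i j) = D.c α i j := fun i j => by
    have h := hTQ (D.c α i j)
    rwa [hQ _ (D.c_mem α i j)] at h
  have hcN : D.c α ^ N = 1 := by
    rw [← Mpow_of_fix T hTc N]; exact (hfix α).1
  obtain ⟨x', q, hx', hn', hq, hS⟩ := partC3 (D.mm α)
    (fun i j => hQ _ (D.c_mem α i j)) hx hN0 hcN hxn
  exact ⟨D.d α, D.c α, x', q, (D.mm α).1, (D.mm α).2,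
    D.li.comp (fun q => ⟨α, q⟩) (fun x y h => by simpa using h), hx', hn', hq, hS⟩
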